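/- Let α ∈ [1,2], let u₁, u₂ ∈ X^{0,1/2,1}, let N₁, N₂ ≥ 1 be dyadic numbers, let 0 < T < 1, and let a ∈ L^∞(R²) with ‖a‖_{L^∞} ≤ 1. Then there exists C > 0 depending only on p_{α+1} such that for every interval I ⊂ R with |I| ≤ (N₁∨N₂)^{−1} T: ‖Λ_a(P_{N₁}u₁, P_{N₂}u₂)‖_{L²(I; L²(T))} ≤ C T^{1/4} (N₁∨N₂)^{−α/4} ‖P_{N₁}u₁‖_{X^{0,1/2,1}} ‖P_{N₂}u₂‖_{X^{0,1/2,1}}. -/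

import Mathlib

open MeasureTheory Complex Real Set Filter
open scoped ENNReal NNReal

noncomputable section

/-- **Hypothesis 1**: `p` is the symbol of the dispersive operator `L_{α+1}`
(the Fourier multiplier by `-i p(ξ)`); `p` is an odd real-valued function of class `C¹`
on `ℝ` and `C²` away from the origin, and for `ξ ≥ ξ₀` the first and second derivatives
of `p` are comparable to `ξ^α` and `ξ^(α-1)` respectively. -/
structure Hyp1 (α ξ₀ c C : ℝ) (p : ℝ → ℝ) : Prop where
  xi0_pos : 0 < ξ₀
  c_pos : 0 < c
  c_le_C : c ≤ C
  smooth1 : ContDiff ℝ 1 p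
  smooth2 : ∀ x : ℝ, x ≠ 0 → ContDiffAt ℝ 2 p x
  odd : ∀ x : ℝ, p (-x) = -p x
  deriv_lb : ∀ ξ : ℝ, ξ₀ ≤ ξ → c * ξ ^ α ≤ deriv p ξ
  deriv_ub : ∀ ξ : ℝ, ξ₀ ≤ ξ → deriv p ξ ≤ C * ξ ^ α
  deriv2_lb : ∀ ξ : ℝ, ξ₀ ≤ ξ → c * ξ ^ (α - 1) ≤ deriv (deriv p) ξ
  deriv2_ub : ∀ ξ : ℝ, ξ₀ ≤ ξ → deriv (deriv p) ξ ≤ C * ξ ^ (α - 1)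

/-- The fixed smooth even cutoff function `χ`: `0 ≤ χ ≤ 1`, `χ ≡ 1` on `[-1,1]`,
`supp χ ⊆ [-2,2]`. -/
structure CutoffFun (χ : ℝ → ℝ) : Prop where
  smooth : ContDiff ℝ (⊤ : ℕ∞) χ
  even : ∀ x : ℝ, χ (-x) = χ x
  nonneg : ∀ x : ℝ, 0 ≤ χ x
  le_one : ∀ x : ℝ, χ x ≤ 1
  eq_one : ∀ x ∈ Set.Icc (-1 : ℝ) 1, χ x = 1
  compact_supp : ∀ x : ℝ, χ x ≠ 0 → x ∈ Set.Icc (-2 : ℝ) 2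

/-- The Littlewood–Paley symbol `φ_N`: for a dyadic `N ≥ 1`, `φ_N(ξ) = χ(ξ/N) - χ(2ξ/N)`,
and `φ_0(ξ) = χ(2ξ)`. -/
def lpSymb (χ : ℝ → ℝ) (N ξ : ℝ) : ℝ :=
  if N = 0 then χ (2 * ξ) else χ (ξ / N) - χ (2 * ξ / N)

/-- The Littlewood–Paley projector `P_N`, acting on the (spatial) Fourier coefficients
of a function on the torus. -/
def PN (χ : ℝ → ℝ) (N : ℝ) (u : ℤ → ℂ) : ℤ → ℂ := fun ξ => (lpSymb χ N ξ : ℂ) * u ξ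

/-- Square of the `L²(𝕋)` norm, computed on Fourier coefficients (Parseval). -/
def l2sq (v : ℤ → ℂ) : ℝ := ∑' ξ : ℤ, ‖v ξ‖ ^ 2

/-- `L²(S × 𝕋)` norm of a space-time function given by its spatial Fourier
coefficients `U t ξ`, `S ⊆ ℝ` a set of times. -/
def L2normOn (S : Set ℝ) (U : ℝ → ℤ → ℂ) : ℝ := (∫ t in S, l2sq (U t)) ^ ((1:ℝ)/2)

/-- `L²(ℝ × 𝕋)` norm. -/
def L2full (U : ℝ → ℤ → ℂ) : ℝ := (∫ t : ℝ, l2sq (U t)) ^ ((1:ℝ)/2)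

/-- `L^∞(]0,T[; L²(𝕋))` norm. -/
def LinfL2 (T : ℝ) (U : ℝ → ℤ → ℂ) : ℝ := ⨆ t : Set.Ioo (0:ℝ) T, (l2sq (U t)) ^ ((1:ℝ)/2)

/-- Membership in `L²(ℝ × 𝕋)`. -/
def MemL2 (U : ℝ → ℤ → ℂ) : Prop :=
  (∀ t : ℝ, Summable fun ξ : ℤ => ‖U t ξ‖ ^ 2) ∧
  (∀ ξ : ℤ, Measurable fun t : ℝ => U t ξ) ∧
  Integrable (fun t : ℝ => l2sq (U t))

/-- Membership in `L^∞(]0,T[; L²(𝕋))`, together with measurability of the coefficients. -/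
def MemLinfL2 (T : ℝ) (U : ℝ → ℤ → ℂ) : Prop :=
  (∀ t ∈ Set.Ioo (0:ℝ) T, Summable fun ξ : ℤ => ‖U t ξ‖ ^ 2) ∧
  (∀ ξ : ℤ, Measurable fun t : ℝ => U t ξ) ∧
  (∃ M : ℝ, ∀ t ∈ Set.Ioo (0:ℝ) T, l2sq (U t) ≤ M)

/-- Continuity with values in `L²(𝕋)` on `[0,T]`. -/
def ContL2On (T : ℝ) (U : ℝ → ℤ → ℂ) : Prop :=
  ∀ t₀ ∈ Set.Icc (0:ℝ) T,
    Filter.Tendsto (fun t => l2sq (fun ξ => U t ξ - U t₀ ξ))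
      (nhdsWithin t₀ (Set.Icc (0:ℝ) T)) (nhds 0)

/-- Time Fourier transform (with the convention `∫ e^{-iτt} g(t) dt`). -/
def FT (g : ℝ → ℂ) (τ : ℝ) : ℂ := ∫ t : ℝ, Complex.exp (-(Complex.I * τ * t)) * g t

/-- Inverse time Fourier transform. -/
def IFT (g : ℝ → ℂ) (t : ℝ) : ℂ :=
  (2 * Real.pi)⁻¹ • ∫ τ : ℝ, Complex.exp (Complex.I * τ * t) * g τ

/-- The modulation projector `Q_L`, a space-time Fourier multiplier with symbol
`ψ_L(τ,ξ) = φ_L(τ - p(ξ))` (acting on spatial Fourier coefficients `U t ξ`). -/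
def QL (χ p : ℝ → ℝ) (L : ℝ) (U : ℝ → ℤ → ℂ) : ℝ → ℤ → ℂ := fun t ξ =>
  IFT (fun τ => (lpSymb χ L (τ - p ξ) : ℂ) * FT (fun s => U s ξ) τ) t

/-- `Q_{≤ 2^l} = Q_0 + ∑_{j ≤ l} Q_{2^j}`. -/
def Qle (χ p : ℝ → ℝ) (l : ℕ) (U : ℝ → ℤ → ℂ) : ℝ → ℤ → ℂ := fun t ξ =>
  QL χ p 0 U t ξ + ∑ j ∈ Finset.range (l + 1), QL χ p ((2:ℝ) ^ j) U t ξ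

/-- The `X^{0,1/2,1}` (Besov–Bourgain) norm:
`‖u‖ = ∑_L max(L,1)^{1/2} ‖Q_L u‖_{L²(ℝ×𝕋)}`, `L` running over `{0} ∪ 2^ℕ`. -/
def Xhalf (χ p : ℝ → ℝ) (U : ℝ → ℤ → ℂ) : ℝ :=
  L2full (QL χ p 0 U) + ∑' l : ℕ, ((2:ℝ) ^ l) ^ ((1:ℝ)/2) * L2full (QL χ p ((2:ℝ) ^ l) U)

/-- Membership in `X^{0,1/2,1}` (with the regularity needed for all the
norms entering the statements to be given by genuinely convergent sums and
integrals). -/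
def MemX (χ p : ℝ → ℝ) (U : ℝ → ℤ → ℂ) : Prop :=
  (∀ ξ : ℤ, Measurable fun t : ℝ => U t ξ) ∧
  (∀ ξ : ℤ, Integrable fun t : ℝ => U t ξ) ∧
  (∀ t : ℝ, Summable fun ξ : ℤ => ‖QL χ p 0 U t ξ‖ ^ 2) ∧
  (∀ l : ℕ, ∀ t : ℝ, Summable fun ξ : ℤ => ‖QL χ p ((2:ℝ) ^ l) U t ξ‖ ^ 2) ∧
  Integrable (fun t : ℝ => l2sq (QL χ p 0 U t)) ∧
  (∀ l : ℕ, Integrable fun t : ℝ => l2sq (QL χ p ((2:ℝ) ^ l) U t)) ∧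
  Summable (fun l : ℕ => ((2:ℝ) ^ l) ^ ((1:ℝ)/2) * L2full (QL χ p ((2:ℝ) ^ l) U))

/-- The bilinear operator `Λ_a`:
`(Λ_a(u,v))^(ξ) = ∑_{ξ₁+ξ₂=ξ} a(ξ₁,ξ₂) û(ξ₁) v̂(ξ₂)`. -/
def Lam (a : ℝ → ℝ → ℂ) (u v : ℤ → ℂ) : ℤ → ℂ := fun ξ =>
  ∑' ξ₁ : ℤ, a ξ₁ ((ξ : ℝ) - ξ₁) * u ξ₁ * v (ξ - ξ₁)

/-- `u` solves `∂_t u + L_{α+1} u + ∂_x f = 0` on `]0,T[ × 𝕋` (in the distributional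
sense), formulated equivalently through the Duhamel formula on each spatial Fourier
mode; `U` and `F` are the spatial Fourier coefficients of `u` and `f`. -/
def Solves (p : ℝ → ℝ) (T : ℝ) (U F : ℝ → ℤ → ℂ) : Prop :=
  ∀ ξ : ℤ, ∀ t ∈ Set.Icc (0:ℝ) T,
    U t ξ = Complex.exp (Complex.I * (p ξ) * t) * U 0 ξ -
      ∫ s in (0:ℝ)..t,
        Complex.exp (Complex.I * (p ξ) * (t - s)) * (Complex.I * (ξ:ℂ)) * F s ξ

/-- Fourier coefficients of the free evolution `e^{-tL_{α+1}} φ`. -/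
def freeEvol (p : ℝ → ℝ) (φ : ℤ → ℂ) : ℝ → ℤ → ℂ := fun t ξ =>
  Complex.exp (Complex.I * (p ξ) * t) * φ ξ


open scoped FourierTransform SchwartzMap in
lemma integral_schwartz_fourier (f : ℝ → ℂ) (hf : Integrable f) (φ : 𝓢(ℝ, ℂ)) :
    ∫ x, φ x * 𝓕 f x = ∫ x, 𝓕 (φ : ℝ → ℂ) x * f x := by
  have := VectorFourier.integral_fourierIntegral_smul_eq_flip (μ := volume) (ν := volume)
    (L := innerₗ ℝ) (f := (φ : ℝ → ℂ)) (g := f)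
    Real.continuous_fourierChar (by fun_prop) φ.integrable hf
  simp only [flip_innerₗ, smul_eq_mul] at this
  exact this.symm

open scoped FourierTransform SchwartzMap in
lemma integral_schwartz_fourierInv (f : ℝ → ℂ) (hf : Integrable f) (φ : 𝓢(ℝ, ℂ)) :
    ∫ x, φ x * 𝓕⁻ f x = ∫ x, 𝓕⁻ (φ : ℝ → ℂ) x * f x := by
  have h := integral_schwartz_fourier (fun x => f (-x)) hf.comp_neg φ
  rw [← integral_neg_eq_self (fun x => 𝓕⁻ (φ : ℝ → ℂ) x * f x)]
  simp only [Real.fourierInv_eq_fourier_comp_neg f]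
  rw [h]
  congr 1; ext x
  rw [Real.fourierInv_eq_fourier_neg]; simp

open scoped ContDiff SchwartzMap in
lemma ae_eq_of_schwartz (f g : ℝ → ℂ) (hf : LocallyIntegrable f) (hg : LocallyIntegrable g)
    (h : ∀ φ : 𝓢(ℝ, ℂ), ∫ x, φ x * f x = ∫ x, φ x * g x) : f =ᵐ[volume] g := by
  apply ae_eq_of_integral_contDiff_smul_eq hf hg
  intro k hk hs
  have hs' : HasCompactSupport (fun x => (k x : ℂ)) :=
    hs.comp_left (g := fun x : ℝ => (x : ℂ)) (by simp)
  have := h (hs'.toSchwartzMap (Complex.ofRealCLM.contDiff.comp hk))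
  simp only [Complex.real_smul]
  exact this

open scoped FourierTransform SchwartzMap in
lemma inversion_ae (f : ℝ → ℂ) (hf : Integrable f) (hf' : Integrable (𝓕 f)) :
    f =ᵐ[volume] 𝓕⁻ (𝓕 f) := by
  apply ae_eq_of_schwartz
  · exact hf.locallyIntegrable
  · rw [Real.fourierInv_eq_fourier_comp_neg]
    exact (VectorFourier.fourierIntegral_continuous Real.continuous_fourierChar (by fun_prop)
      hf'.comp_neg).locallyIntegrable
  intro φ
  rw [integral_schwartz_fourierInv _ hf']
  have := integral_schwartz_fourier f hf (𝓕⁻ φ)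
  rw [← SchwartzMap.fourierInv_coe, this, ← SchwartzMap.fourier_coe]
  simp

open scoped FourierTransform SchwartzMap in
lemma plancherel_fourier (f : ℝ → ℂ) (hf : Integrable f) (hf2 : MemLp f 2) :
    eLpNorm (𝓕 f) 2 volume = eLpNorm f 2 volume := by
  have hae : (𝓕 (hf2.toLp f) : Lp ℂ 2 (volume : Measure ℝ)) =ᵐ[volume] 𝓕 f := by
    apply ae_eq_of_schwartz
    · exact (Lp.memLp _).locallyIntegrable (by norm_num)
    · exact (VectorFourier.fourierIntegral_continuous Real.continuous_fourierChar (by fun_prop)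
        hf).locallyIntegrable
    intro φ
    rw [integral_schwartz_fourier f hf]
    have h1 := congrArg (fun d => d φ) (MeasureTheory.Lp.fourier_toTemperedDistribution_eq (hf2.toLp f))
    simp only [MeasureTheory.Lp.toTemperedDistribution_apply, TemperedDistribution.fourier_apply,
      smul_eq_mul] at h1
    rw [← h1]
    apply integral_congr_ae
    filter_upwards [hf2.coeFn_toLp] with x hx
    rw [hx, SchwartzMap.fourier_coe]
  have h2 := MeasureTheory.Lp.norm_fourier_eq (hf2.toLp f)
  rw [Lp.norm_def, Lp.norm_def, ENNReal.toReal_eq_toReal_iff' (Lp.eLpNorm_ne_top _) (Lp.eLpNorm_ne_top _)] at h2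
  rw [← eLpNorm_congr_ae hae, h2, eLpNorm_congr_ae hf2.coeFn_toLp]

lemma FT_eq (f : ℝ → ℂ) (τ : ℝ) :
    FT f τ = FourierTransform.fourier f (τ / (2 * π)) := by
  rw [Real.fourier_real_eq_integral_exp_smul, FT]
  congr 1; ext t
  rw [smul_eq_mul]; congr 2
  push_cast
  have : (π : ℂ) ≠ 0 := by exact_mod_cast Real.pi_ne_zero
  field_simp

lemma IFT_eq (f : ℝ → ℂ) (t : ℝ) :
    IFT f t = (2 * π)⁻¹ • FT f (-t) := by
  rw [IFT, FT]
  congr 2; ext x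
  congr 2; push_cast; ring

lemma lintegral_comp_div (g : ℝ → ℝ≥0∞) {r : ℝ} (hr : 0 < r) :
    ∫⁻ x, g (x / r) = ENNReal.ofReal r * ∫⁻ x, g x := by
  have h := lintegral_map_equiv (μ := volume) g (MeasurableEquiv.mulRight₀ (r⁻¹) (inv_ne_zero hr.ne'))
  have h2 := Real.map_volume_mul_right (inv_ne_zero hr.ne')
  simp only [MeasurableEquiv.coe_mulRight₀] at h
  rw [h2] at h
  simp only [lintegral_smul_measure, inv_inv, abs_of_pos hr, smul_eq_mul] at h
  simp only [div_eq_mul_inv]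
  exact h.symm

lemma lintegral_sq_eq_eLpNorm (g : ℝ → ℂ) :
    ∫⁻ x, ‖g x‖ₑ ^ 2 = eLpNorm g 2 volume ^ 2 := by
  have := eLpNorm_nnreal_pow_eq_lintegral (f := g) (μ := (volume : Measure ℝ)) (p := 2) (by norm_num)
  simpa using this.symm

lemma plancherel_FT (f : ℝ → ℂ) (hf : Integrable f) (hf2 : MemLp f 2) :
    ∫⁻ τ, ‖FT f τ‖ₑ ^ 2 = ENNReal.ofReal (2 * π) * ∫⁻ x, ‖f x‖ₑ ^ 2 := by
  simp only [FT_eq]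
  rw [lintegral_comp_div (fun x => ‖FourierTransform.fourier f x‖ₑ ^ 2) (by positivity),
    lintegral_sq_eq_eLpNorm, lintegral_sq_eq_eLpNorm, plancherel_fourier f hf hf2]

lemma plancherel_IFT (f : ℝ → ℂ) (hf : Integrable f) (hf2 : MemLp f 2) :
    ENNReal.ofReal (2 * π) * ∫⁻ t, ‖IFT f t‖ₑ ^ 2 = ∫⁻ x, ‖f x‖ₑ ^ 2 := by
  have hpi : 0 < 2 * π := by positivity
  simp only [IFT_eq, enorm_smul, mul_pow]
  rw [lintegral_const_mul' _ _ (ENNReal.pow_ne_top enorm_ne_top), lintegral_neg_eq_self (fun t => ‖FT f t‖ₑ ^ 2),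
    plancherel_FT f hf hf2, ← mul_assoc, ← mul_assoc, Real.enorm_eq_ofReal (by positivity),
    ← ENNReal.ofReal_pow (by positivity), ← ENNReal.ofReal_mul (by positivity),
    ← ENNReal.ofReal_mul (by positivity)]
  have : 2 * π * (2 * π)⁻¹ ^ 2 * (2 * π) = 1 := by field_simp
  rw [this]; simp

lemma FT_continuous (f : ℝ → ℂ) (hf : Integrable f) : Continuous (FT f) := by
  have : FT f = fun τ => FourierTransform.fourier f (τ / (2 * π)) := by
    ext τ; exact FT_eq f τ
  rw [this]
  have hc : Continuous (FourierTransform.fourier f : ℝ → ℂ) :=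
    VectorFourier.fourierIntegral_continuous Real.continuous_fourierChar (by fun_prop) hf
  fun_prop

lemma inversion_FT (f : ℝ → ℂ) (hf : Integrable f) (hf' : Integrable (FT f)) :
    ∀ᵐ t, f t = IFT (FT f) t := by
  have hpi : 0 < 2 * π := by positivity
  have h1 : Integrable (FourierTransform.fourier f : ℝ → ℂ) := by
    have := hf'.comp_mul_right' hpi.ne'
    refine this.congr ?_
    filter_upwards with x
    rw [FT_eq]; congr 1; field_simp
  filter_upwards [inversion_ae f hf h1] with t ht
  rw [ht, IFT, Real.fourierInv_eq']
  set G : ℝ → ℂ := FourierTransform.fourier f with hG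
  have h3 := Measure.integral_comp_div
    (fun τ => cexp (↑(2 * π * inner ℝ τ t) * Complex.I) • G τ) (2 * π)
  rw [abs_of_pos hpi] at h3
  rw [eq_inv_smul_iff₀ hpi.ne', ← h3]
  congr 1; ext τ
  rw [FT_eq, smul_eq_mul]
  congr 2
  simp
  have : (π : ℂ) ≠ 0 := by exact_mod_cast Real.pi_ne_zero
  field_simp

/-- box function -/
def boxF (κ w : ℝ) : ℝ → ℂ := (Set.Icc (w - κ / 2) (w + κ / 2)).indicator (fun _ => 1)

lemma boxF_integrable (κ w : ℝ) : Integrable (boxF κ w) := by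
  refine (integrable_indicator_iff measurableSet_Icc).2 ?_
  exact integrableOn_const (by simp) (by simp)

lemma boxF_memLp (κ w : ℝ) : MemLp (boxF κ w) 2 := by
  refine memLp_indicator_const 2 measurableSet_Icc 1 (Or.inr (by simp))

lemma FT_boxF (κ w t : ℝ) (hκ : 0 < κ) :
    FT (boxF κ w) (-t) = cexp (Complex.I * t * w) * FT (boxF κ 0) (-t) := by
  unfold FT
  rw [← integral_const_mul, ← integral_add_right_eq_self _ w]
  congr 1; ext x
  rw [← mul_assoc, ← Complex.exp_add]
  have : boxF κ w (x + w) = boxF κ 0 x := by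
    unfold boxF
    simp only [Set.indicator, Set.mem_Icc]
    congr 1
    apply propext
    constructor <;> rintro ⟨h1, h2⟩ <;> constructor <;> linarith
  rw [this]
  congr 2; push_cast; ring

lemma FT_boxF_lb (κ t : ℝ) (hκ : 0 < κ) (ht : |t| * κ ≤ 1) :
    κ / 2 ≤ ‖FT (boxF κ 0) (-t)‖ := by
  refine le_trans ?_ (Complex.re_le_norm _)
  have h1 : FT (boxF κ 0) (-t) = ∫ x in Set.Icc (0 - κ / 2) (0 + κ / 2), cexp (Complex.I * t * x) := by
    unfold FT boxF
    rw [← integral_indicator measurableSet_Icc]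
    congr 1; ext x
    by_cases hx : x ∈ Set.Icc (0 - κ / 2) (0 + κ / 2)
    · simp only [Set.indicator_of_mem hx, mul_one]; congr 1; push_cast; ring
    · simp only [Set.indicator_of_notMem hx, mul_zero]
  have hitg : Integrable (fun x : ℝ => cexp (Complex.I * t * x))
      (volume.restrict (Set.Icc (0 - κ / 2) (0 + κ / 2))) :=
    (Continuous.continuousOn (by fun_prop)).integrableOn_Icc
  have h3 := integral_re hitg
  have h4 : (∫ x in Set.Icc (0 - κ / 2) (0 + κ / 2), cexp (Complex.I * t * x)).re
     = ∫ x in Set.Icc (0 - κ / 2) (0 + κ / 2), (cexp (Complex.I * t * x)).re := h3.symm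
  rw [h1, h4]
  have h2 : ∫ x in Set.Icc (0 - κ / 2) (0 + κ / 2), (1 / 2 : ℝ) = κ / 2 := by
    simp [hκ.le]; ring
  refine h2.symm.le.trans ?_
  apply setIntegral_mono_on
  · exact integrableOn_const (by simp) (by simp)
  · exact hitg.re
  · exact measurableSet_Icc
  · intro x hx
    have : Complex.I * t * x = ((t * x : ℝ) : ℂ) * Complex.I := by push_cast; ring
    rw [this, Complex.exp_ofReal_mul_I_re]
    have hx' : |x| ≤ κ / 2 := abs_le.2 ⟨by linarith [hx.1], by linarith [hx.2]⟩
    have h5 : |t * x| ≤ 1 / 2 := by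
      rw [abs_mul]
      nlinarith [abs_nonneg t, abs_nonneg x]
    have h6 := Real.one_sub_sq_div_two_le_cos (x := t * x)
    have h7 : (t * x) ^ 2 ≤ (1 / 2) ^ 2 := sq_le_sq' (by linarith [(abs_le.1 h5).1]) (abs_le.1 h5).2
    linarith

lemma sieve0 (s : Finset ℤ) (c : ℤ → ℂ) (ω : ℤ → ℝ) (κ M : ℝ) (hκ : 0 < κ)
    (hM : ∀ x : ℝ, ((s.filter (fun k => |x - ω k| ≤ κ / 2)).card : ℝ) ≤ M) :
    ∫⁻ t in Set.Icc (-(1 / κ)) (1 / κ), ‖∑ k ∈ s, c k * cexp (Complex.I * t * ω k)‖ₑ ^ 2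
      ≤ ENNReal.ofReal (8 * π * M / κ) * ∑ k ∈ s, ‖c k‖ₑ ^ 2 := by
  have hM0 : 0 ≤ M := le_trans (by positivity) (hM 0)
  set G : ℝ → ℂ := fun x => ∑ k ∈ s, c k * boxF κ (ω k) x with hG
  have hGi : Integrable G := integrable_finsetSum _ fun k _ => (boxF_integrable _ _).const_mul _
  have hG2 : MemLp G 2 := memLp_finsetSum _ fun k _ => (boxF_memLp _ _).const_mul _
  have hFT : ∀ t, FT G (-t) = (∑ k ∈ s, c k * cexp (Complex.I * t * ω k)) * FT (boxF κ 0) (-t) := by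
    intro t
    have : FT G (-t) = ∑ k ∈ s, c k * FT (boxF κ (ω k)) (-t) := by
      unfold FT
      rw [hG]
      simp only [Finset.mul_sum]
      rw [integral_finsetSum]
      · congr 1; ext k
        rw [← integral_const_mul]; congr 1; ext x; ring
      · intro k _
        have : Integrable (fun x => c k * boxF κ (ω k) x) := (boxF_integrable _ _).const_mul _
        refine this.bdd_mul (c := 1) (by fun_prop) ?_
        filter_upwards with x
        have : -(Complex.I * ((-t : ℝ) : ℂ) * x) = ((t * x : ℝ) : ℂ) * Complex.I := by push_cast; ring
        rw [this, Complex.norm_exp_ofReal_mul_I]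
    rw [this, Finset.sum_mul]
    congr 1; ext k
    rw [FT_boxF _ _ _ hκ]; ring
  have h1 : ∀ t ∈ Set.Icc (-(1 / κ)) (1 / κ), ‖∑ k ∈ s, c k * cexp (Complex.I * t * ω k)‖ₑ ^ 2
      ≤ ENNReal.ofReal (4 / κ ^ 2) * ‖FT G (-t)‖ₑ ^ 2 := by
    intro t ht
    have hb := FT_boxF_lb κ t hκ (by
      have : |t| ≤ 1 / κ := abs_le.2 ht
      calc |t| * κ ≤ 1 / κ * κ := by gcongr
        _ = 1 := by field_simp)
    rw [hFT t, enorm_mul, mul_pow, ← ofReal_norm (FT (boxF κ 0) (-t)),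
      ← ENNReal.ofReal_pow (by positivity), mul_left_comm, ← ENNReal.ofReal_mul (by positivity)]
    refine le_mul_of_one_le_right' ?_
    rw [← ENNReal.ofReal_one]
    apply ENNReal.ofReal_le_ofReal
    have : (κ / 2) ^ 2 ≤ ‖FT (boxF κ 0) (-t)‖ ^ 2 := by gcongr
    rw [div_mul_eq_mul_div, le_div_iff₀ (by positivity)]
    nlinarith
  have h2 : ∀ x, ‖G x‖ₑ ^ 2 ≤ ENNReal.ofReal M * ∑ k ∈ s, ‖c k‖ₑ ^ 2 * (Set.Icc (ω k - κ / 2) (ω k + κ / 2)).indicator (fun _ => (1 : ℝ≥0∞)) x := by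
    intro x
    have hmem : ∀ k, x ∈ Set.Icc (ω k - κ / 2) (ω k + κ / 2) ↔ |x - ω k| ≤ κ / 2 := by
      intro k
      rw [abs_le, Set.mem_Icc]
      constructor <;> rintro ⟨h1, h2⟩ <;> constructor <;> linarith
    have e1 : G x = ∑ k ∈ s.filter (fun k => |x - ω k| ≤ κ / 2), c k := by
      rw [hG, Finset.sum_filter]
      refine Finset.sum_congr rfl fun k _ => ?_
      by_cases hk : |x - ω k| ≤ κ / 2
      · rw [if_pos hk, boxF, Set.indicator_of_mem ((hmem k).2 hk), mul_one]
      · rw [if_neg hk, boxF, Set.indicator_of_notMem (fun h => hk ((hmem k).1 h)), mul_zero]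
    have e2 : ∑ k ∈ s, ‖c k‖ₑ ^ 2 * (Set.Icc (ω k - κ / 2) (ω k + κ / 2)).indicator (fun _ => (1 : ℝ≥0∞)) x
        = ∑ k ∈ s.filter (fun k => |x - ω k| ≤ κ / 2), ‖c k‖ₑ ^ 2 := by
      rw [Finset.sum_filter]
      refine Finset.sum_congr rfl fun k _ => ?_
      by_cases hk : |x - ω k| ≤ κ / 2
      · rw [if_pos hk, Set.indicator_of_mem ((hmem k).2 hk), mul_one]
      · rw [if_neg hk, Set.indicator_of_notMem (fun h => hk ((hmem k).1 h)), mul_zero]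
    rw [e1, e2]
    have e3 : ‖∑ k ∈ s.filter (fun k => |x - ω k| ≤ κ / 2), c k‖ ^ 2 ≤
        M * ∑ k ∈ s.filter (fun k => |x - ω k| ≤ κ / 2), ‖c k‖ ^ 2 := by
      calc _ ≤ (∑ k ∈ s.filter (fun k => |x - ω k| ≤ κ / 2), ‖c k‖) ^ 2 := by
            gcongr; exact norm_sum_le _ _
        _ ≤ _ := sq_sum_le_card_mul_sum_sq
        _ ≤ _ := by gcongr; exact hM x
    have e4 := ENNReal.ofReal_le_ofReal e3
    rw [ENNReal.ofReal_mul hM0, ENNReal.ofReal_sum_of_nonneg (fun _ _ => by positivity)] at e4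
    simpa [ENNReal.ofReal_pow, ofReal_norm] using e4
  calc _ ≤ ∫⁻ t in Set.Icc (-(1 / κ)) (1 / κ), ENNReal.ofReal (4 / κ ^ 2) * ‖FT G (-t)‖ₑ ^ 2 :=
        setLIntegral_mono' measurableSet_Icc h1
    _ ≤ ∫⁻ t, ENNReal.ofReal (4 / κ ^ 2) * ‖FT G (-t)‖ₑ ^ 2 := setLIntegral_le_lintegral _ _
    _ = ENNReal.ofReal (4 / κ ^ 2) * (ENNReal.ofReal (2 * π) * ∫⁻ x, ‖G x‖ₑ ^ 2) := by
        rw [lintegral_const_mul' _ _ (by simp), lintegral_neg_eq_self (fun t => ‖FT G t‖ₑ ^ 2),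
          plancherel_FT G hGi hG2]
    _ ≤ ENNReal.ofReal (4 / κ ^ 2) * (ENNReal.ofReal (2 * π) *
          (ENNReal.ofReal M * ∑ k ∈ s, ‖c k‖ₑ ^ 2 * ENNReal.ofReal κ)) := by
        gcongr
        refine (lintegral_mono h2).trans ?_
        rw [lintegral_const_mul' _ _ (by simp), lintegral_finsetSum]
        · gcongr with k _
          rw [lintegral_const_mul' _ _ (ENNReal.pow_ne_top enorm_ne_top),
            lintegral_indicator measurableSet_Icc]
          gcongr
          simp
        · intro k _
          exact (measurable_const.indicator measurableSet_Icc).const_mul _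
    _ = _ := by
        rw [← Finset.sum_mul]
        have : 8 * π * M / κ = 4 / κ ^ 2 * (2 * π * (M * κ)) := by field_simp; ring
        rw [this, ENNReal.ofReal_mul (p := 4 / κ ^ 2) (by positivity),
          ENNReal.ofReal_mul (p := 2 * π) (q := M * κ) (by positivity), ENNReal.ofReal_mul hM0]
        ring

lemma sieve (s : Finset ℤ) (c : ℤ → ℂ) (ω : ℤ → ℝ) (κ M : ℝ) (hκ : 0 < κ)
    (hM : ∀ x : ℝ, ((s.filter (fun k => |x - ω k| ≤ κ / 2)).card : ℝ) ≤ M)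
    (A B : ℝ) (hAB : B - A ≤ 1 / κ) :
    ∫⁻ t in Set.Ioo A B, ‖∑ k ∈ s, c k * cexp (Complex.I * t * ω k)‖ₑ ^ 2
      ≤ ENNReal.ofReal (8 * π * M / κ) * ∑ k ∈ s, ‖c k‖ₑ ^ 2 := by
  have h := sieve0 s (fun k => c k * cexp (Complex.I * A * ω k)) ω κ M hκ hM
  have e1 : ∀ k, ‖c k * cexp (Complex.I * A * ω k)‖ₑ = ‖c k‖ₑ := by
    intro k
    have : Complex.I * A * ω k = ((A * ω k : ℝ) : ℂ) * Complex.I := by push_cast; ring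
    rw [← ofReal_norm, norm_mul, this, Complex.norm_exp_ofReal_mul_I, mul_one,
      ofReal_norm]
  simp only [e1] at h
  refine le_trans ?_ h
  rw [← lintegral_indicator measurableSet_Ioo, ← lintegral_indicator measurableSet_Icc,
    ← lintegral_add_right_eq_self _ A]
  apply lintegral_mono
  intro t
  by_cases ht : t + A ∈ Set.Ioo A B
  · have : t ∈ Set.Icc (-(1 / κ)) (1 / κ) := by
      have : 0 < 1 / κ := by positivity
      constructor <;> linarith [ht.1, ht.2]
    simp only [Set.indicator_of_mem ht, Set.indicator_of_mem this]
    apply le_of_eq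
    congr 3; ext k
    rw [mul_assoc (c k), ← Complex.exp_add]; congr 2; push_cast; ring
  · simp only [Set.indicator_of_notMem ht]; exact bot_le

lemma deriv_gap {α ξ₀ c₀ C₀ : ℝ} (hα : α ∈ Set.Icc (1:ℝ) 2) {p : ℝ → ℝ}
    (hp : Hyp1 α ξ₀ c₀ C₀ p) :
    ∃ X c₁ : ℝ, 1 ≤ X ∧ 0 < c₁ ∧ ∀ x y : ℝ, X ≤ x → 0 ≤ y → y ≤ x →
      c₁ * x ^ (α - 1) * (x - y) ≤ deriv p x - deriv p y := by
  have hcont : Continuous (deriv p) := hp.smooth1.continuous_deriv le_rfl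
  obtain ⟨K, hK⟩ := (isCompact_Icc (a := (0:ℝ)) (b := ξ₀)).exists_bound_of_continuousOn
    hcont.continuousOn
  have hc := hp.c_pos
  have hK0 : 0 ≤ K := le_trans (norm_nonneg _) (hK 0 ⟨le_rfl, hp.xi0_pos.le⟩)
  refine ⟨max (max 1 ξ₀) (2 * K / c₀), c₀ / 4, le_trans (le_max_left _ _) (le_max_left _ _),
    by positivity, ?_⟩
  intro x y hx hy hyx
  have hx1 : 1 ≤ x := le_trans (le_trans (le_max_left _ _) (le_max_left _ _)) hx
  have hxξ : ξ₀ ≤ x := le_trans (le_trans (le_max_right _ _) (le_max_left _ _)) hx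
  have hxK : 2 * K / c₀ ≤ x := le_trans (le_max_right _ _) hx
  have hx0 : 0 < x := by linarith
  have hpow : x ^ α = x ^ (α - 1) * x := by
    rw [← Real.rpow_add_one hx0.ne']; congr 1; ring
  have hpos : 0 < x ^ (α - 1) := Real.rpow_pos_of_pos hx0 _
  have hge1 : 1 ≤ x ^ (α - 1) := Real.one_le_rpow hx1 (by linarith [hα.1])
  rcases le_or_gt y ξ₀ with h | h
  · have h1 := hp.deriv_lb x hxξ
    have h2 := (abs_le.1 (hK y ⟨hy, h⟩)).2
    rw [div_le_iff₀ hc] at hxK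
    rw [hpow] at h1
    have h3 : x ≤ x ^ (α - 1) * x := le_mul_of_one_le_left hx0.le hge1
    have h4 : x ^ (α - 1) * (x - y) ≤ x ^ (α - 1) * x := by gcongr; linarith
    have h5 : 0 ≤ x ^ (α - 1) * (x - y) := mul_nonneg hpos.le (by linarith)
    have h6 : 2 * K ≤ c₀ * (x ^ (α - 1) * x) := by nlinarith
    nlinarith
  · have hdiff : ∀ s : ℝ, ξ₀ < s → DifferentiableAt ℝ (deriv p) s := by
      intro s hs
      have hs0 : s ≠ 0 := (lt_trans hp.xi0_pos hs).ne'
      have := (hp.smooth2 s hs0).derivWithin (m := 1) (by norm_num)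
      exact this.differentiableAt (by norm_num)
    have hmid : y ≤ (x + y) / 2 ∧ (x + y) / 2 ≤ x := ⟨by linarith, by linarith⟩
    have hsub : ∀ s : ℝ, 0 ≤ s ^ (α - 1) ∨ s ≤ 0 := fun s => by
      rcases le_or_gt s 0 with h | h
      · right; exact h
      · left; exact (Real.rpow_pos_of_pos h _).le
    have A1 := (convex_Icc ((x + y) / 2) x).mul_sub_le_image_sub_of_le_deriv
      (f := deriv p) hcont.continuousOn
      (fun s hs => by
        rw [interior_Icc] at hs
        exact (hdiff s (by linarith [hs.1])).differentiableWithinAt)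
      (C := c₀ * (x / 2) ^ (α - 1))
      (fun s hs => by
        rw [interior_Icc] at hs
        refine le_trans ?_ (hp.deriv2_lb s (by linarith [hs.1]))
        gcongr
        · linarith [hα.1]
        · linarith [hs.1])
      ((x + y) / 2) ⟨le_rfl, hmid.2⟩ x ⟨hmid.2, le_rfl⟩ hmid.2
    have A2 := (convex_Icc y ((x + y) / 2)).mul_sub_le_image_sub_of_le_deriv
      (f := deriv p) hcont.continuousOn
      (fun s hs => by
        rw [interior_Icc] at hs
        exact (hdiff s (by linarith [hs.1])).differentiableWithinAt)
      (C := 0)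
      (fun s hs => by
        rw [interior_Icc] at hs
        refine le_trans ?_ (hp.deriv2_lb s (by linarith [hs.1]))
        have : 0 < s := by linarith [hs.1, hp.xi0_pos]
        positivity)
      y ⟨le_rfl, hmid.1⟩ ((x + y) / 2) ⟨hmid.1, le_rfl⟩ hmid.1
    have h7 : x ^ (α - 1) / 2 ≤ (x / 2) ^ (α - 1) := by
      rw [Real.div_rpow hx0.le (by norm_num)]
      gcongr
      calc (2:ℝ) ^ (α - 1) ≤ 2 ^ (1:ℝ) := by
            apply Real.rpow_le_rpow_of_exponent_le (by norm_num); linarith [hα.2]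
        _ = 2 := by simp
    have h8 : c₀ * (x ^ (α - 1) / 2) * (x - (x + y) / 2) ≤ c₀ * (x / 2) ^ (α - 1) * (x - (x + y) / 2) := by
      gcongr
      linarith
    nlinarith

lemma deriv_even_of_odd {p : ℝ → ℝ} (hodd : ∀ x : ℝ, p (-x) = -p x) (x : ℝ) :
    deriv p (-x) = deriv p x := by
  have h1 : (fun y => p (-y)) = fun y => - p y := by ext y; exact hodd y
  have h2 := deriv_comp_neg p x
  have h3 : deriv (fun y => p (-y)) x = - deriv p x := by rw [h1]; simp
  rw [h3] at h2
  linarith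

lemma deriv_abs_of_odd {p : ℝ → ℝ} (hodd : ∀ x : ℝ, p (-x) = -p x) (x : ℝ) :
    deriv p x = deriv p |x| := by
  rcases abs_choice x with h | h
  · rw [h]
  · rw [h, deriv_even_of_odd hodd]

lemma spacing_dir {α ξ₀ c₀ C₀ : ℝ} (hα : α ∈ Set.Icc (1:ℝ) 2) {p : ℝ → ℝ}
    (hp : Hyp1 α ξ₀ c₀ C₀ p) {X c₁ : ℝ} (hX : 1 ≤ X) (hc : 0 < c₁)
    (hgap : ∀ x y : ℝ, X ≤ x → 0 ≤ y → y ≤ x →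
      c₁ * x ^ (α - 1) * (x - y) ≤ deriv p x - deriv p y)
    {N M ξ x₁ x₂ : ℝ} (hN : 2 * X ≤ N) (hM : 0 < M) (hξ : M < ξ) (h12 : x₁ ≤ x₂)
    (hx : N / 2 ≤ x₁) (hx' : M < 2 * x₁ - ξ) :
    c₁ / 2 * N ^ (α - 1) * M * (x₂ - x₁) ≤ (p x₂ + p (ξ - x₂)) - (p x₁ + p (ξ - x₁)) := by
  have hdp : Differentiable ℝ p := hp.smooth1.differentiable (by norm_num)
  have hd : ∀ x, HasDerivAt (fun x => p x + p (ξ - x)) (deriv p x - deriv p (ξ - x)) x := by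
    intro x
    have h1 := (hdp x).hasDerivAt
    have h2 : HasDerivAt (fun y => ξ - y) (-1) x := by
      simpa using (hasDerivAt_id x).const_sub ξ
    have h3 := (hdp (ξ - x)).hasDerivAt.comp x h2
    have h4 := h1.add h3
    have e : deriv p x + deriv p (ξ - x) * -1 = deriv p x - deriv p (ξ - x) := by ring
    rw [e] at h4
    exact h4
  refine (convex_Icc x₁ x₂).mul_sub_le_image_sub_of_le_deriv
      (f := fun x => p x + p (ξ - x))
      (fun x _ => (hd x).continuousAt.continuousWithinAt)
      (fun x _ => (hd x).differentiableAt.differentiableWithinAt)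
      (fun s hs => ?_) x₁ ⟨le_rfl, h12⟩ x₂ ⟨h12, le_rfl⟩ h12
  rw [interior_Icc] at hs
  rw [(hd s).deriv, deriv_abs_of_odd hp.odd (ξ - s)]
  have hs1 := hs.1
  have hN0 : 0 < N := by linarith
  have habs : |ξ - s| ≤ s - M := abs_le.2 ⟨by linarith, by linarith⟩
  refine le_trans ?_ (hgap s |ξ - s| (by linarith) (abs_nonneg _) (by linarith))
  have h7 : N ^ (α - 1) / 2 ≤ s ^ (α - 1) := by
    calc N ^ (α - 1) / 2 ≤ (N / 2) ^ (α - 1) := by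
          rw [Real.div_rpow hN0.le (by norm_num)]
          gcongr
          calc (2:ℝ) ^ (α - 1) ≤ 2 ^ (1:ℝ) := by
                apply Real.rpow_le_rpow_of_exponent_le (by norm_num); linarith [hα.2]
            _ = 2 := by simp
      _ ≤ s ^ (α - 1) := by
          gcongr
          · linarith [hα.1]
          · linarith
  calc c₁ / 2 * N ^ (α - 1) * M = c₁ * (N ^ (α - 1) / 2) * M := by ring
    _ ≤ c₁ * s ^ (α - 1) * (s - |ξ - s|) := by
      have hs0 : 0 < s := by linarith
      gcongr
      linarith

lemma spacing {α ξ₀ c₀ C₀ : ℝ} (hα : α ∈ Set.Icc (1:ℝ) 2) {p : ℝ → ℝ}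
    (hp : Hyp1 α ξ₀ c₀ C₀ p) {X c₁ : ℝ} (hX : 1 ≤ X) (hc : 0 < c₁)
    (hgap : ∀ x y : ℝ, X ≤ x → 0 ≤ y → y ≤ x →
      c₁ * x ^ (α - 1) * (x - y) ≤ deriv p x - deriv p y)
    {N M ξ x₁ x₂ : ℝ} (hN : 2 * X ≤ N) (hM : 0 < M) (hξ : M < |ξ|)
    (hx1 : N / 2 ≤ max |x₁| |ξ - x₁|) (hx2 : N / 2 ≤ max |x₂| |ξ - x₂|)
    (hreg : (M < 2 * x₁ - ξ ∧ M < 2 * x₂ - ξ) ∨ (2 * x₁ - ξ < -M ∧ 2 * x₂ - ξ < -M)) :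
    c₁ / 2 * N ^ (α - 1) * M * |x₂ - x₁| ≤ |(p x₂ + p (ξ - x₂)) - (p x₁ + p (ξ - x₁))| := by
  -- first region, with positive sum
  have key1 : ∀ ξ x₁ x₂ : ℝ, M < ξ → N / 2 ≤ max |x₁| |ξ - x₁| → N / 2 ≤ max |x₂| |ξ - x₂| →
      M < 2 * x₁ - ξ → M < 2 * x₂ - ξ →
      c₁ / 2 * N ^ (α - 1) * M * |x₂ - x₁| ≤ |(p x₂ + p (ξ - x₂)) - (p x₁ + p (ξ - x₁))| := by
    intro ξ x₁ x₂ hξ h1 h2 h3 h4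
    have e : ∀ x, M < 2 * x - ξ → N / 2 ≤ max |x| |ξ - x| → N / 2 ≤ x := by
      intro x hx h
      have e1 : |ξ - x| ≤ x := abs_le.2 ⟨by linarith, by linarith⟩
      have e2 : |x| ≤ x := abs_le.2 ⟨by linarith, le_rfl⟩
      exact h.trans (max_le e2 e1)
    rcases le_total x₁ x₂ with h | h
    · rw [abs_of_nonneg (sub_nonneg.2 h)]
      exact (spacing_dir hα hp hX hc hgap hN hM hξ h (e _ h3 h1) h3).trans (le_abs_self _)
    · rw [abs_sub_comm, abs_of_nonneg (sub_nonneg.2 h), abs_sub_comm]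
      exact (spacing_dir hα hp hX hc hgap hN hM hξ h (e _ h4 h2) h4).trans (le_abs_self _)
  have key2 : ∀ ξ x₁ x₂ : ℝ, M < ξ → N / 2 ≤ max |x₁| |ξ - x₁| → N / 2 ≤ max |x₂| |ξ - x₂| →
      (M < 2 * x₁ - ξ ∧ M < 2 * x₂ - ξ) ∨ (2 * x₁ - ξ < -M ∧ 2 * x₂ - ξ < -M) →
      c₁ / 2 * N ^ (α - 1) * M * |x₂ - x₁| ≤ |(p x₂ + p (ξ - x₂)) - (p x₁ + p (ξ - x₁))| := by
    intro ξ x₁ x₂ hξ h1 h2 h3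
    rcases h3 with h3 | h3
    · exact key1 ξ x₁ x₂ hξ h1 h2 h3.1 h3.2
    · have := key1 ξ (ξ - x₁) (ξ - x₂) hξ (by rwa [sub_sub_cancel, max_comm])
        (by rwa [sub_sub_cancel, max_comm]) (by linarith [h3.1]) (by linarith [h3.2])
      rw [sub_sub_cancel, sub_sub_cancel, sub_sub_sub_cancel_left, abs_sub_comm x₁] at this
      rwa [add_comm (p x₂), add_comm (p x₁)]
  rcases lt_abs.1 hξ with h | h
  · exact key2 ξ x₁ x₂ h hx1 hx2 hreg
  · have e : ∀ x, |-ξ - -x| = |ξ - x| := fun x => by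
      rw [← abs_neg]; congr 1; ring
    have := key2 (-ξ) (-x₁) (-x₂) h (by rwa [abs_neg, e]) (by rwa [abs_neg, e])
      (hreg.symm.imp (fun h => ⟨by linarith [h.1], by linarith [h.2]⟩)
        (fun h => ⟨by linarith [h.1], by linarith [h.2]⟩))
    have e2 : ∀ x, p (-ξ - -x) = - p (ξ - x) := fun x => by
      rw [← hp.odd]; congr 1; ring
    rw [e2, e2, hp.odd, hp.odd, ← abs_neg (-x₂ - -x₁), ← abs_neg (-p x₂ + _ - _)] at this
    convert this using 3 <;> ring

lemma card_le_of_spacing (G : Finset ℤ) (w : ℤ → ℝ) (m κ : ℝ) (hm : 0 < m) (hκ : 0 ≤ κ)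
    (h1 : ∀ j ∈ G, ∀ k ∈ G, m * |(k : ℝ) - j| ≤ |w k - w j|)
    (h2 : ∀ j ∈ G, ∀ k ∈ G, |w k - w j| ≤ κ) : (G.card : ℝ) ≤ κ / m + 1 := by
  rcases G.eq_empty_or_nonempty with rfl | hne
  · simp; positivity
  set a := G.min' hne
  set b := G.max' hne
  have hab : a ≤ b := G.min'_le _ (G.max'_mem hne)
  have hsub : G ⊆ Finset.Icc a b := fun x hx =>
    Finset.mem_Icc.2 ⟨G.min'_le _ hx, G.le_max' _ hx⟩
  have hcard := Finset.card_le_card hsub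
  rw [Int.card_Icc] at hcard
  have h3 : ((G.card : ℤ)) ≤ b + 1 - a := by omega
  have h4 : (G.card : ℝ) ≤ b + 1 - a := by exact_mod_cast h3
  have h5 := (h1 a (G.min'_mem hne) b (G.max'_mem hne)).trans (h2 a (G.min'_mem hne) b (G.max'_mem hne))
  have h6 : (b : ℝ) - a ≤ κ / m := by
    rw [le_div_iff₀ hm, mul_comm]
    exact le_trans (by gcongr; exact le_abs_self _) h5
  linarith

lemma card_le_of_diam (G : Finset ℤ) (D : ℝ) (hD : 0 ≤ D)
    (h2 : ∀ j ∈ G, ∀ k ∈ G, |(k : ℝ) - j| ≤ D) : (G.card : ℝ) ≤ D + 1 := by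
  have := card_le_of_spacing G (fun k => (k : ℝ)) 1 D one_pos hD (by simp) h2
  simpa using this

lemma counting {α ξ₀ c₀ C₀ : ℝ} (hα : α ∈ Set.Icc (1:ℝ) 2) {p : ℝ → ℝ}
    (hp : Hyp1 α ξ₀ c₀ C₀ p) :
    ∃ K : ℝ, 0 < K ∧ ∀ (N T M κ : ℝ), 1 ≤ N → 0 < T → T < 1 →
      1 ≤ M → κ = N ^ (α - 1) * M ^ 2 →
      ∀ (s : Finset ℤ) (ξ : ℤ), M < |(ξ : ℝ)| →
      (∀ x ∈ s, N / 2 ≤ max |(x : ℝ)| |(ξ : ℝ) - x|) → (∀ x ∈ s, |(x : ℝ)| ≤ 2 * N) →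
      ∀ z : ℝ, ((s.filter (fun x : ℤ => |z - (p x + p (ξ - x))| ≤ κ / 2)).card : ℝ) ≤ K * M := by
  obtain ⟨X, c₁, hX, hc, hgap⟩ := deriv_gap hα hp
  refine ⟨8 * X + 4 + 4 / c₁, by positivity, ?_⟩
  intro N T M κ hN hT hT1 hM hκ s ξ hξ hs1 hs2 z
  have hN0 : 0 < N := by linarith
  have hpos : 0 < N ^ (α - 1) := Real.rpow_pos_of_pos hN0 _
  have hκ0 : 0 ≤ κ := by rw [hκ]; positivity
  rcases lt_or_ge N (2 * X) with hNX | hNX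
  · have h1 : (s.card : ℝ) ≤ 4 * N + 1 := by
      apply card_le_of_diam _ _ (by positivity)
      intro j hj k hk
      have := abs_sub (k : ℝ) j
      linarith [hs2 j hj, hs2 k hk]
    have h2 : ((s.filter (fun x : ℤ => |z - (p x + p (ξ - x))| ≤ κ / 2)).card : ℝ) ≤ s.card := by
      exact_mod_cast Finset.card_filter_le _ _
    have h3 : 0 < 4 / c₁ := by positivity
    nlinarith
  · set F := s.filter (fun x : ℤ => |z - (p x + p (ξ - x))| ≤ κ / 2) with hF
    have hFs : ∀ x ∈ F, x ∈ s ∧ |z - (p x + p (ξ - x))| ≤ κ / 2 := fun x hx => by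
      simpa [hF] using hx
    have hcl : ∀ j ∈ F, ∀ k ∈ F, |(p k + p (ξ - k)) - (p j + p (ξ - j))| ≤ κ := by
      intro j hj k hk
      have h1 := (hFs j hj).2
      have h2 := (hFs k hk).2
      rw [abs_le] at h1 h2 ⊢
      constructor <;> linarith
    set m := c₁ / 2 * N ^ (α - 1) * M with hm
    have hm0 : 0 < m := by positivity
    have hκm : κ / m = 2 / c₁ * M := by
      rw [hκ, hm]; field_simp
    set F1 := F.filter (fun x : ℤ => M < 2 * (x : ℝ) - ξ)
    set F2 := F.filter (fun x : ℤ => 2 * (x : ℝ) - ξ < -M)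
    set F3 := F.filter (fun x : ℤ => |2 * (x : ℝ) - ξ| ≤ M)
    have hcov : F ⊆ F1 ∪ (F2 ∪ F3) := by
      intro x hx
      simp only [F1, F2, F3, Finset.mem_union, Finset.mem_filter, hx, true_and]
      by_contra! hcon
      obtain ⟨h1, h2, h3⟩ := hcon
      exact absurd (abs_le.2 ⟨h2, h1⟩) (not_le.2 h3)
    have hcard : (F.card : ℝ) ≤ F1.card + (F2.card + F3.card) := by
      have h1 := Finset.card_le_card hcov
      have h2 := Finset.card_union_le F1 (F2 ∪ F3)
      have h3 := Finset.card_union_le F2 F3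
      exact_mod_cast (by omega : F.card ≤ F1.card + (F2.card + F3.card))
    have hF1 : (F1.card : ℝ) ≤ κ / m + 1 := by
      refine card_le_of_spacing F1 (fun x => p x + p (ξ - x)) m κ hm0 hκ0 ?_ ?_
      · intro j hj k hk
        simp only [F1, Finset.mem_filter] at hj hk
        exact spacing hα hp hX hc hgap hNX (by linarith) hξ (hs1 j (hFs j hj.1).1)
          (hs1 k (hFs k hk.1).1) (Or.inl ⟨hj.2, hk.2⟩)
      · intro j hj k hk
        simp only [F1, Finset.mem_filter] at hj hk
        exact hcl j hj.1 k hk.1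
    have hF2 : (F2.card : ℝ) ≤ κ / m + 1 := by
      refine card_le_of_spacing F2 (fun x => p x + p (ξ - x)) m κ hm0 hκ0 ?_ ?_
      · intro j hj k hk
        simp only [F2, Finset.mem_filter] at hj hk
        exact spacing hα hp hX hc hgap hNX (by linarith) hξ (hs1 j (hFs j hj.1).1)
          (hs1 k (hFs k hk.1).1) (Or.inr ⟨hj.2, hk.2⟩)
      · intro j hj k hk
        simp only [F2, Finset.mem_filter] at hj hk
        exact hcl j hj.1 k hk.1
    have hF3 : (F3.card : ℝ) ≤ M + 1 := by
      apply card_le_of_diam _ _ (by linarith)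
      intro j hj k hk
      simp only [F3, Finset.mem_filter, abs_le] at hj hk
      rw [abs_le]
      constructor <;> linarith [hj.2.1, hj.2.2, hk.2.1, hk.2.2]
    rw [hκm] at hF1 hF2
    have h4 : 4 / c₁ * M = 2 / c₁ * M + 2 / c₁ * M := by ring
    nlinarith

/-- bilinear expression for free solutions -/
def bilF (p : ℝ → ℝ) (S₁ S₂ : Finset ℤ) (a : ℝ → ℝ → ℂ) (f g : ℤ → ℂ) (ξ : ℤ) (t : ℝ) : ℂ :=
  ∑ k ∈ S₁.filter (fun k => ξ - k ∈ S₂), (a k ((ξ : ℝ) - k) * f k * g (ξ - k)) *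
    cexp (Complex.I * t * ((p k + p (ξ - k) : ℝ) : ℂ))

lemma sum_shift_le (S₁ S₂ : Finset ℤ) (G : ℤ → ℝ≥0∞) (ξ : ℤ) :
    ∑ k ∈ S₁.filter (fun k => ξ - k ∈ S₂), G (ξ - k) ≤ ∑ l ∈ S₂, G l := by
  rw [← Finset.sum_image (f := G) (g := fun k => ξ - k) (s := S₁.filter (fun k => ξ - k ∈ S₂))]
  · apply Finset.sum_le_sum_of_subset
    intro x hx
    simp only [Finset.mem_image, Finset.mem_filter] at hx
    obtain ⟨k, hk, rfl⟩ := hx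
    exact hk.2
  · intro x _ y _ h
    simpa using h

lemma bilF_triv (p : ℝ → ℝ) (S₁ S₂ : Finset ℤ) (a : ℝ → ℝ → ℂ) (ha : ∀ x y : ℝ, ‖a x y‖ ≤ 1)
    (f g : ℤ → ℂ) (ξ : ℤ) (t : ℝ) :
    ‖bilF p S₁ S₂ a f g ξ t‖ₑ ^ 2 ≤ (∑ k ∈ S₁, ‖f k‖ₑ ^ 2) * ∑ k ∈ S₂, ‖g k‖ₑ ^ 2 := by
  have h1 : ‖bilF p S₁ S₂ a f g ξ t‖ ^ 2 ≤ (∑ k ∈ S₁.filter (fun k => ξ - k ∈ S₂), ‖f k‖ ^ 2) *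
      ∑ k ∈ S₁.filter (fun k => ξ - k ∈ S₂), ‖g (ξ - k)‖ ^ 2 := by
    refine le_trans ?_ (Finset.sum_mul_sq_le_sq_mul_sq _ _ _)
    gcongr
    refine (norm_sum_le _ _).trans ?_
    apply Finset.sum_le_sum
    intro k _
    have : Complex.I * t * ((p k + p (ξ - k) : ℝ) : ℂ) = ((t * (p k + p (ξ - k)) : ℝ) : ℂ) * Complex.I := by
      push_cast; ring
    rw [norm_mul, norm_mul, norm_mul, this, Complex.norm_exp_ofReal_mul_I, mul_one]
    gcongr
    exact mul_le_of_le_one_left (norm_nonneg _) (ha _ _)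
  have h2 := ENNReal.ofReal_le_ofReal h1
  rw [ENNReal.ofReal_mul (by positivity), ENNReal.ofReal_sum_of_nonneg (fun _ _ => by positivity),
    ENNReal.ofReal_sum_of_nonneg (fun _ _ => by positivity)] at h2
  simp only [ENNReal.ofReal_pow (norm_nonneg _), ofReal_norm] at h2
  refine h2.trans ?_
  gcongr
  · exact Finset.filter_subset _ _
  · exact sum_shift_le S₁ S₂ (fun l => ‖g l‖ₑ ^ 2) ξ

lemma free_bilinear {α ξ₀ c₀ C₀ : ℝ} (hα : α ∈ Set.Icc (1:ℝ) 2) {p : ℝ → ℝ}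
    (hp : Hyp1 α ξ₀ c₀ C₀ p) :
    ∃ C : ℝ, 0 < C ∧ ∀ (N T : ℝ), 1 ≤ N → 0 < T → T < 1 →
      ∀ (S₁ S₂ : Finset ℤ), (∀ k ∈ S₁, |(k : ℝ)| ≤ 2 * N) →
      (∀ k ∈ S₁, ∀ l ∈ S₂, N / 2 ≤ max |(k : ℝ)| |(l : ℝ)|) →
      ∀ (a : ℝ → ℝ → ℂ), (∀ x y : ℝ, ‖a x y‖ ≤ 1) →
      ∀ (A B : ℝ), B - A ≤ N⁻¹ * T → ∀ (Z : Finset ℤ) (f g : ℤ → ℂ),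
      ∑ ξ ∈ Z, ∫⁻ t in Set.Ioo A B, ‖bilF p S₁ S₂ a f g ξ t‖ₑ ^ 2 ≤
        ENNReal.ofReal (C * (T ^ ((1:ℝ)/2) * N ^ (-(α/2)))) *
          ((∑ k ∈ S₁, ‖f k‖ₑ ^ 2) * ∑ k ∈ S₂, ‖g k‖ₑ ^ 2) := by
  obtain ⟨K, hK, hcount⟩ := counting hα hp
  refine ⟨3 + 8 * π * K, by positivity, ?_⟩
  intro N T hN hT hT1 S₁ S₂ hS1 hS2 a ha A B hAB Z f g
  have hN0 : 0 < N := by linarith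
  set M : ℝ := T ^ (-(1:ℝ)/2) * N ^ (1 - α / 2) with hM
  set E : ℝ := T ^ ((1:ℝ)/2) * N ^ (-(α/2)) with hE
  have hE0 : 0 < E := by positivity
  have hM0 : 0 < M := by positivity
  have hM1 : 1 ≤ M := by
    have h1 : 1 ≤ T ^ (-(1:ℝ)/2) := Real.one_le_rpow_of_pos_of_le_one_of_nonpos hT hT1.le (by norm_num)
    have h2 : 1 ≤ N ^ (1 - α / 2) := Real.one_le_rpow hN (by linarith [hα.2])
    nlinarith
  have hME : M * (N⁻¹ * T) = E := by
    have e1 : T ^ ((1:ℝ)/2) = T ^ (-(1:ℝ)/2) * T := by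
      rw [← Real.rpow_add_one hT.ne']; norm_num
    have e2 : N ^ (1 - α / 2) = N ^ (-(α/2)) * N := by
      rw [← Real.rpow_add_one hN0.ne']; congr 1; ring
    rw [hM, hE, e1, e2]; field_simp
  have hκM : N / T = N ^ (α - 1) * M ^ 2 := by
    have e1 : (T ^ (-(1:ℝ)/2)) ^ 2 = T⁻¹ := by
      rw [← Real.rpow_natCast, ← Real.rpow_mul hT.le, ← Real.rpow_neg_one]; norm_num
    have e2 : N ^ (α - 1) * (N ^ (1 - α / 2)) ^ 2 = N := by
      rw [← Real.rpow_natCast, ← Real.rpow_mul hN0.le, ← Real.rpow_add hN0]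
      have : α - 1 + (1 - α / 2) * ((2:ℕ):ℝ) = 1 := by push_cast; ring
      rw [this, Real.rpow_one]
    rw [hM, mul_pow, e1, mul_left_comm, e2]; field_simp
  set P := ∑ k ∈ S₁, ‖f k‖ₑ ^ 2
  set Q := ∑ k ∈ S₂, ‖g k‖ₑ ^ 2
  rw [← Finset.sum_filter_add_sum_filter_not Z (fun ξ : ℤ => |(ξ:ℝ)| ≤ M)]
  have hlow : ∑ ξ ∈ Z.filter (fun ξ : ℤ => |(ξ:ℝ)| ≤ M),
      ∫⁻ t in Set.Ioo A B, ‖bilF p S₁ S₂ a f g ξ t‖ₑ ^ 2 ≤ ENNReal.ofReal (3 * E) * (P * Q) := by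
    have h1 : ∀ ξ ∈ Z.filter (fun ξ : ℤ => |(ξ:ℝ)| ≤ M),
        ∫⁻ t in Set.Ioo A B, ‖bilF p S₁ S₂ a f g ξ t‖ₑ ^ 2 ≤ ENNReal.ofReal (N⁻¹ * T) * (P * Q) := by
      intro ξ _
      calc _ ≤ ∫⁻ t in Set.Ioo A B, P * Q := lintegral_mono fun t => bilF_triv p S₁ S₂ a ha f g ξ t
        _ = P * Q * ENNReal.ofReal (B - A) := by simp
        _ ≤ _ := by rw [mul_comm]; gcongr
    refine (Finset.sum_le_card_nsmul _ _ _ h1).trans ?_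
    have hc : ((Z.filter (fun ξ : ℤ => |(ξ:ℝ)| ≤ M)).card : ℝ) ≤ 2 * M + 1 := by
      apply card_le_of_diam _ _ (by linarith)
      intro j hj k hk
      simp only [Finset.mem_filter] at hj hk
      have := abs_sub (k : ℝ) j
      linarith [hj.2, hk.2]
    rw [nsmul_eq_mul, ← mul_assoc]
    gcongr
    rw [← ENNReal.ofReal_natCast, ← ENNReal.ofReal_mul (by positivity)]
    apply ENNReal.ofReal_le_ofReal
    have h0 : 0 ≤ N⁻¹ * T := by positivity
    have h3 : ((Z.filter (fun ξ : ℤ => |(ξ:ℝ)| ≤ M)).card : ℝ) ≤ 3 * M := by linarith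
    rw [← hME]
    calc _ ≤ 3 * M * (N⁻¹ * T) := mul_le_mul_of_nonneg_right h3 h0
      _ = _ := by ring
  have hhigh : ∑ ξ ∈ Z.filter (fun ξ : ℤ => ¬ |(ξ:ℝ)| ≤ M),
      ∫⁻ t in Set.Ioo A B, ‖bilF p S₁ S₂ a f g ξ t‖ₑ ^ 2 ≤ ENNReal.ofReal (8 * π * K * E) * (P * Q) := by
    have h1 : ∀ ξ ∈ Z.filter (fun ξ : ℤ => ¬ |(ξ:ℝ)| ≤ M),
        ∫⁻ t in Set.Ioo A B, ‖bilF p S₁ S₂ a f g ξ t‖ₑ ^ 2 ≤ ENNReal.ofReal (8 * π * K * E) *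
          ∑ k ∈ S₁, ‖f k‖ₑ ^ 2 * (if ξ - k ∈ S₂ then ‖g (ξ - k)‖ₑ ^ 2 else 0) := by
      intro ξ hξ
      simp only [Finset.mem_filter, not_le] at hξ
      have hs := sieve (S₁.filter (fun k => ξ - k ∈ S₂))
        (fun k => a k ((ξ : ℝ) - k) * f k * g (ξ - k)) (fun k => p k + p (ξ - k)) (N / T) (K * M)
        (by positivity) (fun z => ?_) A B (by rw [one_div_div, div_eq_inv_mul]; exact hAB)
      · refine hs.trans ?_
        have e1 : 8 * π * (K * M) / (N / T) = 8 * π * K * E := by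
          rw [← hME]; field_simp
        rw [e1, Finset.sum_filter]
        gcongr with k _
        split_ifs with hk
        · rw [enorm_mul, enorm_mul, mul_pow, mul_pow]
          gcongr
          refine mul_le_of_le_one_left' ?_
          apply pow_le_one₀ bot_le
          rw [← ofReal_norm, ← ENNReal.ofReal_one]
          exact ENNReal.ofReal_le_ofReal (ha _ _)
        · simp
      · refine hcount N T M (N / T) hN hT hT1 hM1 hκM _ ξ hξ.2 ?_ ?_ z
        · intro x hx
          simp only [Finset.mem_filter] at hx
          have := hS2 x hx.1 _ hx.2
          push_cast at this
          exact this
        · intro x hx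
          simp only [Finset.mem_filter] at hx
          exact hS1 x hx.1
    refine (Finset.sum_le_sum h1).trans ?_
    rw [← Finset.mul_sum, Finset.sum_comm]
    gcongr
    rw [Finset.sum_mul]
    gcongr with k _
    rw [← Finset.mul_sum]
    gcongr
    rw [← Finset.sum_filter]
    rw [← Finset.sum_image (f := fun l => ‖g l‖ₑ ^ 2) (g := fun x => x - k)]
    · apply Finset.sum_le_sum_of_subset
      intro x hx
      simp only [Finset.mem_image, Finset.mem_filter] at hx
      obtain ⟨k, hk, rfl⟩ := hx
      exact hk.2
    · intro x _ y _ h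
      simpa using h
  refine (add_le_add hlow hhigh).trans ?_
  rw [← add_mul, ← ENNReal.ofReal_add (by positivity) (by positivity)]
  apply le_of_eq; congr 2; ring

lemma minkowski2 {X S : Type*} [MeasurableSpace X] [MeasurableSpace S] (μ : Measure X)
    (ν : Measure S) [SFinite μ] [SFinite ν] (k : X → S → ℝ≥0∞)
    (hk : Measurable (Function.uncurry k)) :
    ∫⁻ x, (∫⁻ s, k x s ∂ν) ^ 2 ∂μ ≤ (∫⁻ s, (∫⁻ x, k x s ^ 2 ∂μ) ^ ((1:ℝ)/2) ∂ν) ^ 2 := by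
  have hk1 : ∀ x, Measurable (k x) := fun x => hk.comp measurable_prodMk_left
  have hk2 : ∀ s, Measurable (fun x => k x s) := fun s => hk.comp measurable_prodMk_right
  set b : S → ℝ≥0∞ := fun s => (∫⁻ x, k x s ^ 2 ∂μ) ^ ((1:ℝ)/2) with hb
  have hbm : Measurable b := by
    have h1 : Measurable (Function.uncurry fun s x => k x s ^ 2) :=
      (hk.comp measurable_swap).pow_const 2
    exact (h1.lintegral_prod_right).pow_const _
  have hCS : ∀ s s', ∫⁻ x, k x s * k x s' ∂μ ≤ b s * b s' := by
    intro s s'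
    have := ENNReal.lintegral_mul_le_Lp_mul_Lq μ Real.HolderConjugate.two_two
      (hk2 s).aemeasurable (hk2 s').aemeasurable
    simpa [hb] using this
  have hsw : ∀ s, ∫⁻ x, ∫⁻ s', k x s * k x s' ∂ν ∂μ = ∫⁻ s', ∫⁻ x, k x s * k x s' ∂μ ∂ν := by
    intro s
    apply lintegral_lintegral_swap
    exact (((hk2 s).comp measurable_fst).mul hk).aemeasurable
  calc ∫⁻ x, (∫⁻ s, k x s ∂ν) ^ 2 ∂μ = ∫⁻ x, ∫⁻ s, ∫⁻ s', k x s * k x s' ∂ν ∂ν ∂μ := by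
        congr 1; ext x
        rw [sq, ← lintegral_mul_const _ (hk1 x)]
        congr 1; ext s
        rw [lintegral_const_mul _ (hk1 x)]
    _ = ∫⁻ s, ∫⁻ x, ∫⁻ s', k x s * k x s' ∂ν ∂μ ∂ν := by
        apply lintegral_lintegral_swap
        apply Measurable.aemeasurable
        have : Measurable (Function.uncurry fun (q : X × S) (s' : S) => k q.1 q.2 * k q.1 s') := by
          have h1 : Measurable fun r : (X × S) × S => k r.1.1 r.1.2 := hk.comp measurable_fst
          have h2 : Measurable fun r : (X × S) × S => k r.1.1 r.2 :=
            hk.comp ((measurable_fst.comp measurable_fst).prodMk measurable_snd)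
          exact h1.mul h2
        exact this.lintegral_prod_right
    _ = ∫⁻ s, ∫⁻ s', ∫⁻ x, k x s * k x s' ∂μ ∂ν ∂ν := by
        congr 1; ext s; exact hsw s
    _ ≤ ∫⁻ s, ∫⁻ s', b s * b s' ∂ν ∂ν := lintegral_mono fun s => lintegral_mono fun s' => hCS s s'
    _ = (∫⁻ s, b s ∂ν) ^ 2 := by
        rw [sq, ← lintegral_mul_const _ hbm]
        congr 1; ext s
        rw [lintegral_const_mul _ hbm]

lemma lpSymb_abs_le {χ : ℝ → ℝ} (hχ : CutoffFun χ) (N ξ : ℝ) : |lpSymb χ N ξ| ≤ 1 := by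
  rw [abs_le, lpSymb]
  split_ifs
  · constructor <;> linarith [hχ.nonneg (2 * ξ), hχ.le_one (2 * ξ)]
  · constructor <;> linarith [hχ.nonneg (ξ / N), hχ.le_one (ξ / N), hχ.nonneg (2 * ξ / N),
      hχ.le_one (2 * ξ / N)]

lemma lpSymb_supp {χ : ℝ → ℝ} (hχ : CutoffFun χ) {N : ℝ} (hN : 0 < N) {ξ : ℝ}
    (h : lpSymb χ N ξ ≠ 0) : |ξ| ≤ 2 * N ∧ N / 2 ≤ |ξ| := by
  rw [lpSymb, if_neg hN.ne'] at h
  have hz : ∀ x, 2 < |x| → χ x = 0 := by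
    intro x hx
    by_contra hc
    have := hχ.compact_supp x hc
    rw [Set.mem_Icc, ← abs_le] at this
    linarith
  have ho : ∀ x, |x| ≤ 1 → χ x = 1 := fun x hx => hχ.eq_one x (by rwa [Set.mem_Icc, ← abs_le])
  have e1 : |ξ / N| = |ξ| / N := by rw [abs_div, abs_of_pos hN]
  have e2 : |2 * ξ / N| = 2 * |ξ| / N := by rw [abs_div, abs_of_pos hN, abs_mul]; norm_num
  constructor
  · by_contra! hc
    apply h
    rw [hz, hz, sub_self]
    · rw [e2, lt_div_iff₀ hN]; linarith [abs_nonneg ξ]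
    · rw [e1, lt_div_iff₀ hN]; linarith
  · by_contra! hc
    apply h
    rw [ho, ho, sub_self]
    · rw [e2, div_le_one hN]; linarith
    · rw [e1, div_le_one hN]; linarith

lemma lpSymb_supp0 {χ : ℝ → ℝ} (hχ : CutoffFun χ) {ξ : ℝ}
    (h : lpSymb χ 0 ξ ≠ 0) : |ξ| ≤ 1 := by
  rw [lpSymb, if_pos rfl] at h
  have := hχ.compact_supp _ h
  rw [Set.mem_Icc] at this
  rw [abs_le]; constructor <;> linarith

lemma lpSymb_continuous {χ : ℝ → ℝ} (hχ : CutoffFun χ) (N : ℝ) : Continuous (lpSymb χ N) := by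
  have := hχ.smooth.continuous
  unfold lpSymb
  split_ifs <;> fun_prop

lemma lpSymb_sum (χ : ℝ → ℝ) (σ : ℝ) (m : ℕ) :
    lpSymb χ 0 σ + ∑ l ∈ Finset.range (m + 1), lpSymb χ ((2:ℝ) ^ l) σ = χ (σ / 2 ^ m) := by
  induction m with
  | zero => simp [lpSymb]
  | succ m ih =>
    rw [Finset.sum_range_succ, ← add_assoc, ih]
    have : (2:ℝ) ^ (m + 1) ≠ 0 := by positivity
    rw [lpSymb, if_neg this]
    have : 2 * σ / 2 ^ (m + 1) = σ / 2 ^ m := by rw [pow_succ]; field_simp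
    rw [this]; ring

lemma one_le_partition {χ : ℝ → ℝ} (hχ : CutoffFun χ) (σ : ℝ) :
    1 ≤ ‖lpSymb χ 0 σ‖ₑ + ∑' l : ℕ, ‖lpSymb χ ((2:ℝ) ^ l) σ‖ₑ := by
  obtain ⟨m, hm⟩ := pow_unbounded_of_one_lt |σ| (one_lt_two)
  have h1 : χ (σ / 2 ^ m) = 1 := by
    apply hχ.eq_one
    rw [Set.mem_Icc, ← abs_le, abs_div, abs_of_pos (by positivity : (0:ℝ) < 2 ^ m),
      div_le_one (by positivity)]
    exact hm.le
  have h2 := lpSymb_sum χ σ m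
  rw [h1] at h2
  calc (1 : ℝ≥0∞) = ‖lpSymb χ 0 σ + ∑ l ∈ Finset.range (m + 1), lpSymb χ ((2:ℝ) ^ l) σ‖ₑ := by
        rw [h2]; simp
    _ ≤ ‖lpSymb χ 0 σ‖ₑ + ∑ l ∈ Finset.range (m + 1), ‖lpSymb χ ((2:ℝ) ^ l) σ‖ₑ := by
        refine (enorm_add_le _ _).trans ?_
        gcongr
        exact enorm_sum_le _ _
    _ ≤ _ := by gcongr; exact ENNReal.sum_le_tsum _

lemma QL_mul (χ p : ℝ → ℝ) (L : ℝ) (U : ℝ → ℤ → ℂ) (c : ℤ → ℂ) (t : ℝ) (k : ℤ) :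
    QL χ p L (fun t k => c k * U t k) t k = c k * QL χ p L U t k := by
  have h : ∀ τ, FT (fun s => c k * U s k) τ = c k * FT (fun s => U s k) τ := by
    intro τ
    rw [FT, FT, ← integral_const_mul]
    congr 1; ext s; ring
  simp only [QL, h]
  rw [IFT, IFT, mul_smul_comm, ← integral_const_mul]
  congr 2; ext s; ring

lemma QL_zero (χ p : ℝ → ℝ) (L : ℝ) (V : ℝ → ℤ → ℂ) (k : ℤ) (h : ∀ t, V t k = 0) (t : ℝ) :
    QL χ p L V t k = 0 := by
  simp [QL, h, FT, IFT]

/-- bound for one modulation block -/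
lemma block_bound {χ : ℝ → ℝ} (hχ : CutoffFun χ) (p : ℝ → ℝ) (L M : ℝ) (hM : 0 < M)
    (hL : ∀ x, lpSymb χ L x ≠ 0 → |x| ≤ 2 * M) (V : ℝ → ℤ → ℂ) (S : Finset ℤ)
    (hV : ∀ k, Integrable fun t => V t k) (hS : ∀ k ∉ S, ∀ t, V t k = 0) :
    ∫⁻ σ, ‖lpSymb χ L σ‖ₑ * (∑ k ∈ S, ‖FT (fun t => V t k) (σ + p k)‖ₑ ^ 2) ^ ((1:ℝ)/2) ≤
      ENNReal.ofReal ((8 * π) ^ ((1:ℝ)/2) * (M ^ ((1:ℝ)/2) * L2full (QL χ p L V))) := by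
  have hFc : ∀ k, Continuous (FT (fun t => V t k)) := fun k => FT_continuous _ (hV k)
  have hlc := lpSymb_continuous hχ L
  have hpos : (0:ℝ) < 1 / 2 := by norm_num
  set H : ℝ → ℝ≥0∞ := fun σ => ∑ k ∈ S, ‖(lpSymb χ L σ : ℂ) * FT (fun t => V t k) (σ + p k)‖ₑ ^ 2
    with hH
  have hHm : Measurable H := by
    apply Finset.measurable_sum
    intro k _
    have : Continuous fun σ : ℝ => (lpSymb χ L σ : ℂ) * FT (fun t => V t k) (σ + p k) := by
      have := hFc k
      fun_prop
    exact this.measurable.enorm.pow_const 2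
  have e1 : ∀ σ, ‖lpSymb χ L σ‖ₑ * (∑ k ∈ S, ‖FT (fun t => V t k) (σ + p k)‖ₑ ^ 2) ^ ((1:ℝ)/2) =
      (Set.Icc (-(2 * M)) (2 * M)).indicator (fun _ => 1) σ * H σ ^ ((1:ℝ)/2) := by
    intro σ
    have e2 : H σ = ‖lpSymb χ L σ‖ₑ ^ 2 * ∑ k ∈ S, ‖FT (fun t => V t k) (σ + p k)‖ₑ ^ 2 := by
      rw [hH, Finset.mul_sum]
      refine Finset.sum_congr rfl fun k _ => ?_
      rw [enorm_mul, mul_pow]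
      congr 2
      simp [← ofReal_norm]
    rw [e2, ENNReal.mul_rpow_of_nonneg _ _ hpos.le, ← ENNReal.rpow_natCast, ← ENNReal.rpow_mul]
    by_cases h : lpSymb χ L σ = 0
    · simp [h]
    · rw [Set.indicator_of_mem (by rw [Set.mem_Icc, ← abs_le]; exact hL σ h)]
      norm_num
  simp_rw [e1]
  have hCS := ENNReal.lintegral_mul_le_Lp_mul_Lq volume Real.HolderConjugate.two_two
    (f := (Set.Icc (-(2 * M)) (2 * M)).indicator (fun _ => (1 : ℝ≥0∞)))
    (g := fun σ => H σ ^ ((1:ℝ)/2))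
    ((measurable_const.indicator measurableSet_Icc).aemeasurable) (hHm.pow_const _).aemeasurable
  refine hCS.trans ?_
  have e3 : ∫⁻ σ, ((Set.Icc (-(2 * M)) (2 * M)).indicator (fun _ => (1 : ℝ≥0∞)) σ) ^ (2:ℝ) =
      ENNReal.ofReal (4 * M) := by
    have : ∀ σ, ((Set.Icc (-(2 * M)) (2 * M)).indicator (fun _ => (1 : ℝ≥0∞)) σ) ^ (2:ℝ) =
        (Set.Icc (-(2 * M)) (2 * M)).indicator (fun _ => (1 : ℝ≥0∞)) σ := by
      intro σ
      by_cases h : σ ∈ Set.Icc (-(2 * M)) (2 * M)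
      · simp [Set.indicator_of_mem h]
      · simp [Set.indicator_of_notMem h]
    simp_rw [this]
    rw [lintegral_indicator measurableSet_Icc]
    simp only [lintegral_const, one_mul, Measure.restrict_apply_univ, Real.volume_Icc]
    congr 1; ring
  have e4 : ∀ σ, (H σ ^ ((1:ℝ)/2)) ^ (2:ℝ) = H σ := by
    intro σ; rw [← ENNReal.rpow_mul]; norm_num
  -- the kernel functions
  set w : ℤ → ℝ → ℂ := fun k τ => (lpSymb χ L (τ - p k) : ℂ) * FT (fun t => V t k) τ with hw
  have hwc : ∀ k, Continuous (w k) := by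
    intro k
    have := hFc k
    simp only [hw]
    fun_prop
  have hws : ∀ k, HasCompactSupport (w k) := by
    intro k
    apply HasCompactSupport.intro (K := Set.Icc (p k - 2 * M) (p k + 2 * M)) isCompact_Icc
    intro x hx
    have : lpSymb χ L (x - p k) = 0 := by
      by_contra hc
      have := abs_le.1 (hL _ hc)
      apply hx
      constructor <;> linarith
    simp [hw, this]
  have hpl : ∀ k, ENNReal.ofReal (2 * π) * ∫⁻ t, ‖QL χ p L V t k‖ₑ ^ 2 = ∫⁻ τ, ‖w k τ‖ₑ ^ 2 :=
    fun k => plancherel_IFT (w k) ((hwc k).integrable_of_hasCompactSupport (hws k))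
      ((hwc k).memLp_of_hasCompactSupport (hws k))
  have hwfin : ∀ k, ∫⁻ τ, ‖w k τ‖ₑ ^ 2 < ∞ := by
    intro k
    rw [lintegral_sq_eq_eLpNorm]
    exact ENNReal.pow_lt_top ((hwc k).memLp_of_hasCompactSupport (hws k)).eLpNorm_lt_top
  have hQc : ∀ k, Continuous fun t => QL χ p L V t k := by
    intro k
    have : (fun t => QL χ p L V t k) = fun t => (2 * π)⁻¹ • FT (w k) (-t) := by
      ext t; exact IFT_eq (w k) t
    rw [this]
    have := FT_continuous (w k) ((hwc k).integrable_of_hasCompactSupport (hws k))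
    fun_prop
  have hpi0 : ENNReal.ofReal (2 * π) ≠ 0 := by
    rw [Ne, ENNReal.ofReal_eq_zero, not_le]; positivity
  have hl2 : ∀ t, l2sq (QL χ p L V t) = ∑ k ∈ S, ‖QL χ p L V t k‖ ^ 2 := by
    intro t
    rw [l2sq, tsum_eq_sum]
    intro k hk
    rw [QL_zero χ p L V k (hS k hk) t]; simp
  have hl2e : ∀ t, ENNReal.ofReal (l2sq (QL χ p L V t)) = ∑ k ∈ S, ‖QL χ p L V t k‖ₑ ^ 2 := by
    intro t
    rw [hl2, ENNReal.ofReal_sum_of_nonneg (fun _ _ => by positivity)]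
    refine Finset.sum_congr rfl fun k _ => ?_
    rw [ENNReal.ofReal_pow (norm_nonneg _), ofReal_norm]
  have hnn : ∀ t, 0 ≤ l2sq (QL χ p L V t) := fun t => tsum_nonneg fun _ => by positivity
  have e5 : ∫⁻ σ, H σ = ENNReal.ofReal (2 * π) * ENNReal.ofReal (∫ t, l2sq (QL χ p L V t)) := by
    have h1 : ∫⁻ σ, H σ = ∑ k ∈ S, ∫⁻ τ, ‖w k τ‖ₑ ^ 2 := by
      rw [hH, lintegral_finsetSum']
      · refine Finset.sum_congr rfl fun k _ => ?_
        rw [← lintegral_add_right_eq_self (fun τ => ‖w k τ‖ₑ ^ 2) (p k)]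
        simp [hw]
      · intro k _
        have : Continuous fun σ : ℝ => (lpSymb χ L σ : ℂ) * FT (fun t => V t k) (σ + p k) := by
          have := hFc k
          fun_prop
        exact (this.measurable.enorm.pow_const 2).aemeasurable
    have h2 : ∫⁻ t, ENNReal.ofReal (l2sq (QL χ p L V t)) =
        ∑ k ∈ S, ∫⁻ t, ‖QL χ p L V t k‖ₑ ^ 2 := by
      simp_rw [hl2e]
      rw [lintegral_finsetSum']
      intro k _
      exact ((hQc k).measurable.enorm.pow_const 2).aemeasurable
    have hitg : Integrable fun t => l2sq (QL χ p L V t) := by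
      refine ⟨?_, ?_⟩
      · simp_rw [hl2]
        have : Continuous fun t => ∑ k ∈ S, ‖QL χ p L V t k‖ ^ 2 :=
          continuous_finsetSum _ fun k _ => ((hQc k).norm.pow 2)
        exact this.aestronglyMeasurable
      · rw [hasFiniteIntegral_iff_ofReal (Eventually.of_forall hnn), h2]
        apply ENNReal.sum_lt_top.2
        intro k _
        have := hwfin k
        rw [← hpl] at this
        exact ENNReal.lt_top_of_mul_ne_top_right this.ne hpi0
    rw [ofReal_integral_eq_lintegral_ofReal hitg (Eventually.of_forall hnn), h2, h1, Finset.mul_sum]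
    exact Finset.sum_congr rfl fun k _ => (hpl k).symm
  have hI0 : 0 ≤ ∫ t, l2sq (QL χ p L V t) := integral_nonneg hnn
  simp only [e3, e4, e5]
  rw [← ENNReal.ofReal_mul (by positivity), ENNReal.ofReal_rpow_of_nonneg (by positivity) hpos.le,
    ENNReal.ofReal_rpow_of_nonneg (by positivity) hpos.le, ← ENNReal.ofReal_mul (by positivity)]
  apply ENNReal.ofReal_le_ofReal
  rw [L2full, ← Real.mul_rpow (by positivity) (by positivity), ← Real.mul_rpow (by positivity) (by positivity),
    ← Real.mul_rpow (by positivity) (by positivity)]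
  apply le_of_eq; congr 1; ring

lemma L2full_nonneg (U : ℝ → ℤ → ℂ) : 0 ≤ L2full U :=
  Real.rpow_nonneg (integral_nonneg fun _ => tsum_nonneg fun _ => by positivity) _

lemma Xhalf_nonneg (χ p : ℝ → ℝ) (U : ℝ → ℤ → ℂ) : 0 ≤ Xhalf χ p U :=
  add_nonneg (L2full_nonneg _) (tsum_nonneg fun _ => mul_nonneg (by positivity) (L2full_nonneg _))

lemma X_bound {χ : ℝ → ℝ} (hχ : CutoffFun χ) (p : ℝ → ℝ) (V : ℝ → ℤ → ℂ) (S : Finset ℤ)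
    (hV : ∀ k, Integrable fun t => V t k) (hS : ∀ k ∉ S, ∀ t, V t k = 0)
    (hsum : Summable (fun l : ℕ => ((2:ℝ) ^ l) ^ ((1:ℝ)/2) * L2full (QL χ p ((2:ℝ) ^ l) V))) :
    ∫⁻ σ, (∑ k ∈ S, ‖FT (fun t => V t k) (σ + p k)‖ₑ ^ 2) ^ ((1:ℝ)/2) ≤
      ENNReal.ofReal ((8 * π) ^ ((1:ℝ)/2) * Xhalf χ p V) := by
  set h : ℝ → ℝ≥0∞ := fun σ => (∑ k ∈ S, ‖FT (fun t => V t k) (σ + p k)‖ₑ ^ 2) ^ ((1:ℝ)/2) with hh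
  have hm : Measurable h := by
    refine (Finset.measurable_sum _ fun k _ => ?_).pow_const _
    have : Continuous fun σ : ℝ => FT (fun t => V t k) (σ + p k) := by
      have := FT_continuous _ (hV k)
      fun_prop
    exact this.measurable.enorm.pow_const 2
  have hlm : ∀ L, Measurable fun σ => ‖lpSymb χ L σ‖ₑ * h σ := fun L =>
    (lpSymb_continuous hχ L).measurable.enorm.mul hm
  have hb : ∀ l : ℕ, ∫⁻ σ, ‖lpSymb χ ((2:ℝ) ^ l) σ‖ₑ * h σ ≤ ENNReal.ofReal
      ((8 * π) ^ ((1:ℝ)/2) * (((2:ℝ) ^ l) ^ ((1:ℝ)/2) * L2full (QL χ p ((2:ℝ) ^ l) V))) :=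
    fun l => block_bound hχ p _ _ (by positivity)
      (fun x hx => (lpSymb_supp hχ (by positivity) hx).1) V S hV hS
  have hb0 : ∫⁻ σ, ‖lpSymb χ 0 σ‖ₑ * h σ ≤ ENNReal.ofReal
      ((8 * π) ^ ((1:ℝ)/2) * L2full (QL χ p 0 V)) := by
    have := block_bound hχ p 0 1 (by positivity)
      (fun x hx => (lpSymb_supp0 hχ hx).trans (by norm_num)) V S hV hS
    rw [Real.one_rpow, one_mul] at this
    exact this
  calc ∫⁻ σ, h σ ≤ ∫⁻ σ, (‖lpSymb χ 0 σ‖ₑ * h σ + ∑' l : ℕ, ‖lpSymb χ ((2:ℝ) ^ l) σ‖ₑ * h σ) := by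
        refine lintegral_mono fun σ => ?_
        dsimp only
        rw [ENNReal.tsum_mul_right, ← add_mul]
        exact le_mul_of_one_le_left' (one_le_partition hχ σ)
    _ = (∫⁻ σ, ‖lpSymb χ 0 σ‖ₑ * h σ) + ∑' l : ℕ, ∫⁻ σ, ‖lpSymb χ ((2:ℝ) ^ l) σ‖ₑ * h σ := by
        rw [lintegral_add_left (hlm 0), lintegral_tsum fun l => (hlm _).aemeasurable]
    _ ≤ ENNReal.ofReal ((8 * π) ^ ((1:ℝ)/2) * L2full (QL χ p 0 V)) + ∑' l : ℕ, ENNReal.ofReal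
      ((8 * π) ^ ((1:ℝ)/2) * (((2:ℝ) ^ l) ^ ((1:ℝ)/2) * L2full (QL χ p ((2:ℝ) ^ l) V))) := by
        gcongr with l
        exact hb l
    _ = _ := by
        have hn : ∀ l : ℕ, 0 ≤ (8 * π) ^ ((1:ℝ)/2) *
            (((2:ℝ) ^ l) ^ ((1:ℝ)/2) * L2full (QL χ p ((2:ℝ) ^ l) V)) := fun l =>
          mul_nonneg (by positivity) (mul_nonneg (by positivity) (L2full_nonneg _))
        rw [← ENNReal.ofReal_tsum_of_nonneg hn (hsum.mul_left _), ← ENNReal.ofReal_add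
          (mul_nonneg (by positivity) (L2full_nonneg _)) (tsum_nonneg hn), tsum_mul_left, ← mul_add]
        rfl

lemma PN_summable {χ : ℝ → ℝ} (hχ : CutoffFun χ) (p : ℝ → ℝ) (N : ℝ) (U : ℝ → ℤ → ℂ)
    (hU : MemX χ p U) :
    Summable (fun l : ℕ => ((2:ℝ) ^ l) ^ ((1:ℝ)/2) *
      L2full (QL χ p ((2:ℝ) ^ l) (fun t => PN χ N (U t)))) := by
  obtain ⟨-, -, -, h4, -, h6, h7⟩ := hU
  refine Summable.of_nonneg_of_le (fun l => mul_nonneg (by positivity) (L2full_nonneg _))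
    (fun l => ?_) h7
  refine mul_le_mul_of_nonneg_left ?_ (by positivity)
  refine Real.rpow_le_rpow (integral_nonneg fun _ => tsum_nonneg fun _ => by positivity) ?_
    (by norm_num)
  refine integral_mono_of_nonneg (Eventually.of_forall fun _ => tsum_nonneg fun _ => by positivity)
    (h6 l) (Eventually.of_forall fun t => ?_)
  have hle : ∀ k, ‖QL χ p ((2:ℝ) ^ l) (fun t => PN χ N (U t)) t k‖ ^ 2 ≤
      ‖QL χ p ((2:ℝ) ^ l) U t k‖ ^ 2 := by
    intro k
    have := QL_mul χ p ((2:ℝ) ^ l) U (fun k => (lpSymb χ N k : ℂ)) t k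
    have e : (fun t => PN χ N (U t)) = fun t k => (lpSymb χ N (k:ℤ) : ℂ) * U t k := rfl
    rw [e, this, norm_mul]
    gcongr
    refine mul_le_of_le_one_left (norm_nonneg _) ?_
    rw [Complex.norm_real]
    exact lpSymb_abs_le hχ _ _
  exact Summable.tsum_le_tsum hle
    (Summable.of_nonneg_of_le (fun _ => by positivity) hle (h4 l t)) (h4 l t)

/-- representation of a function with integrable Fourier transform as superposition of free waves -/
lemma repr_free (p : ℝ → ℝ) (V : ℝ → ℤ → ℂ) (S : Finset ℤ) (X : ℝ)
    (hV : ∀ k, Integrable fun t => V t k)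
    (hX : ∫⁻ σ, (∑ k ∈ S, ‖FT (fun t => V t k) (σ + p k)‖ₑ ^ 2) ^ ((1:ℝ)/2) ≤ ENNReal.ofReal X) :
    (∀ k ∈ S, Integrable fun σ => FT (fun t => V t k) (σ + p k)) ∧
    ∀ᵐ t : ℝ, ∀ k ∈ S, V t k = ((2 * π)⁻¹ : ℝ) • ∫ σ : ℝ,
      cexp (Complex.I * (σ + p k : ℝ) * t) * FT (fun t => V t k) (σ + p k) := by
  have hFc : ∀ k, Continuous (FT (fun t => V t k)) := fun k => FT_continuous _ (hV k)
  have h1 : ∀ k ∈ S, Integrable fun σ => FT (fun t => V t k) (σ + p k) := by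
    intro k hk
    refine ⟨?_, ?_⟩
    · have := hFc k
      have : Continuous fun σ => FT (fun t => V t k) (σ + p k) := by fun_prop
      exact this.aestronglyMeasurable
    · refine lt_of_le_of_lt (lintegral_mono fun σ => ?_) (hX.trans_lt ENNReal.ofReal_lt_top)
      calc ‖FT (fun t => V t k) (σ + p k)‖ₑ
          = (‖FT (fun t => V t k) (σ + p k)‖ₑ ^ 2) ^ ((1:ℝ)/2) := by
            rw [← ENNReal.rpow_natCast, ← ENNReal.rpow_mul]; norm_num
        _ ≤ _ := by
            apply ENNReal.rpow_le_rpow _ (by norm_num)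
            exact Finset.single_le_sum (f := fun k : ℤ => ‖FT (fun t => V t k) (σ + p k)‖ₑ ^ 2)
              (fun _ _ => bot_le) hk
  refine ⟨h1, ?_⟩
  rw [Finset.eventually_all]
  intro k hk
  have h2 : Integrable (FT fun t => V t k) := by
    have := (h1 k hk).comp_sub_right (p k)
    simpa using this
  filter_upwards [inversion_FT _ (hV k) h2] with t ht
  rw [ht, IFT]
  congr 1
  rw [← integral_add_right_eq_self
    (fun τ : ℝ => cexp (Complex.I * τ * t) * FT (fun t => V t k) τ) (p k)]

lemma meas_kk (Z : Finset ℤ) (b : ℤ → ℝ → ℝ × ℝ → ℝ≥0∞)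
    (hb : ∀ ξ, Measurable fun q : ℝ × (ℝ × ℝ) => b ξ q.1 q.2) :
    Measurable (Function.uncurry fun (x : Z × ℝ) (s : ℝ × ℝ) => b x.1 x.2 s) := by
  have h1 : Measurable fun q : (ℝ × (ℝ × ℝ)) × Z => b q.2 q.1.1 q.1.2 :=
    measurable_from_prod_countable_left fun ξ => hb ξ
  have h2 : Measurable fun q : (Z × ℝ) × (ℝ × ℝ) => ((q.1.2, q.2), q.1.1) := by fun_prop
  exact h1.comp h2

set_option maxHeartbeats 1000000 in
lemma transfer (p : ℝ → ℝ) (V₁ V₂ : ℝ → ℤ → ℂ) (S₁ S₂ Z : Finset ℤ) (X₁ X₂ A B : ℝ) (E : ℝ≥0∞)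
    (a : ℝ → ℝ → ℂ)
    (hV₁ : ∀ k, Integrable fun t => V₁ t k) (hV₂ : ∀ k, Integrable fun t => V₂ t k)
    (hS₁ : ∀ k ∉ S₁, ∀ t, V₁ t k = 0) (hS₂ : ∀ k ∉ S₂, ∀ t, V₂ t k = 0)
    (hX₁ : ∫⁻ σ, (∑ k ∈ S₁, ‖FT (fun t => V₁ t k) (σ + p k)‖ₑ ^ 2) ^ ((1:ℝ)/2) ≤ ENNReal.ofReal X₁)
    (hX₂ : ∫⁻ σ, (∑ k ∈ S₂, ‖FT (fun t => V₂ t k) (σ + p k)‖ₑ ^ 2) ^ ((1:ℝ)/2) ≤ ENNReal.ofReal X₂)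
    (hfree : ∀ f g : ℤ → ℂ, ∑ ξ ∈ Z, ∫⁻ t in Set.Ioo A B, ‖bilF p S₁ S₂ a f g ξ t‖ₑ ^ 2 ≤
        E * ((∑ k ∈ S₁, ‖f k‖ₑ ^ 2) * ∑ k ∈ S₂, ‖g k‖ₑ ^ 2)) :
    ∫⁻ t in Set.Ioo A B, ∑ ξ ∈ Z, ‖Lam a (V₁ t) (V₂ t) ξ‖ₑ ^ 2 ≤
      E * (ENNReal.ofReal X₁ * ENNReal.ofReal X₂) ^ 2 := by
  obtain ⟨hi₁, hr₁⟩ := repr_free p V₁ S₁ X₁ hV₁ hX₁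
  obtain ⟨hi₂, hr₂⟩ := repr_free p V₂ S₂ X₂ hV₂ hX₂
  have hc₁ : ∀ k, Continuous (FT (fun t => V₁ t k)) := fun k => FT_continuous _ (hV₁ k)
  have hc₂ : ∀ k, Continuous (FT (fun t => V₂ t k)) := fun k => FT_continuous _ (hV₂ k)
  set f : ℝ → ℤ → ℂ := fun σ k => FT (fun t => V₁ t k) (σ + p k) with hf
  set g : ℝ → ℤ → ℂ := fun σ k => FT (fun t => V₂ t k) (σ + p k) with hg
  have hfc : ∀ k, Continuous fun σ => f σ k := by
    intro k; have := hc₁ k; simp only [hf]; fun_prop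
  have hgc : ∀ k, Continuous fun σ => g σ k := by
    intro k; have := hc₂ k; simp only [hg]; fun_prop
  -- pointwise bound
  have hpt : ∀ᵐ t : ℝ, ∀ ξ : ℤ, ‖Lam a (V₁ t) (V₂ t) ξ‖ₑ ≤
      ∫⁻ s : ℝ × ℝ, ‖bilF p S₁ S₂ a (f s.1) (g s.2) ξ t‖ₑ := by
    filter_upwards [hr₁, hr₂] with t h1 h2 ξ
    have hL : Lam a (V₁ t) (V₂ t) ξ = ((2 * π)⁻¹ * (2 * π)⁻¹ : ℝ) • ∫ s : ℝ × ℝ,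
        cexp (Complex.I * t * (s.1 + s.2 : ℝ)) * bilF p S₁ S₂ a (f s.1) (g s.2) ξ t := by
      have e1 : Lam a (V₁ t) (V₂ t) ξ = ∑ k ∈ S₁.filter (fun k => ξ - k ∈ S₂),
          a k ((ξ : ℝ) - k) * V₁ t k * V₂ t (ξ - k) := by
        rw [Lam, tsum_eq_sum]
        intro k hk
        rw [Finset.mem_filter, not_and_or] at hk
        rcases hk with hk | hk
        · rw [hS₁ k hk]; simp
        · rw [hS₂ _ hk]; simp
      have e2 : ∀ s : ℝ × ℝ, cexp (Complex.I * t * (s.1 + s.2 : ℝ)) *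
          bilF p S₁ S₂ a (f s.1) (g s.2) ξ t =
          ∑ k ∈ S₁.filter (fun k => ξ - k ∈ S₂), a k ((ξ : ℝ) - k) *
            ((cexp (Complex.I * (s.1 + p k : ℝ) * t) * f s.1 k) *
              (cexp (Complex.I * (s.2 + p (ξ - k : ℤ) : ℝ) * t) * g s.2 (ξ - k))) := by
        intro s
        rw [bilF, Finset.mul_sum]
        refine Finset.sum_congr rfl fun k _ => ?_
        have : cexp (Complex.I * t * (s.1 + s.2 : ℝ)) *
            cexp (Complex.I * t * ((p k + p (ξ - k) : ℝ) : ℂ)) =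
            cexp (Complex.I * (s.1 + p k : ℝ) * t) *
              cexp (Complex.I * (s.2 + p (ξ - k : ℤ) : ℝ) * t) := by
          rw [← Complex.exp_add, ← Complex.exp_add]
          congr 1
          push_cast
          ring
        linear_combination (a k ((ξ : ℝ) - k) * f s.1 k * g s.2 (ξ - k)) * this
      have hi1 : ∀ k ∈ S₁, Integrable fun σ : ℝ => cexp (Complex.I * (σ + p k : ℝ) * t) * f σ k := by
        intro k hk
        refine (hi₁ k hk).bdd_mul (c := 1) ?_ (Eventually.of_forall fun σ => ?_)
        · exact (by fun_prop : Continuous fun σ : ℝ =>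
            cexp (Complex.I * (σ + p k : ℝ) * t)).aestronglyMeasurable
        · rw [Complex.norm_exp]; simp
      have hi2 : ∀ k ∈ S₂, Integrable fun σ : ℝ => cexp (Complex.I * (σ + p k : ℝ) * t) * g σ k := by
        intro k hk
        refine (hi₂ k hk).bdd_mul (c := 1) ?_ (Eventually.of_forall fun σ => ?_)
        · exact (by fun_prop : Continuous fun σ : ℝ =>
            cexp (Complex.I * (σ + p k : ℝ) * t)).aestronglyMeasurable
        · rw [Complex.norm_exp]; simp
      simp_rw [e2]
      rw [integral_finsetSum, e1, Finset.smul_sum]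
      · refine Finset.sum_congr rfl fun k hk => ?_
        rw [Finset.mem_filter] at hk
        rw [integral_const_mul, Measure.volume_eq_prod, integral_prod_mul
          (fun σ : ℝ => cexp (Complex.I * (σ + p k : ℝ) * t) * f σ k)
          (fun σ : ℝ => cexp (Complex.I * (σ + p (ξ - k : ℤ) : ℝ) * t) * g σ (ξ - k)),
          h1 k hk.1, h2 _ hk.2]
        simp only [Complex.real_smul, hf, hg]
        push_cast
        ring
      · intro k hk
        rw [Finset.mem_filter] at hk
        exact ((hi1 k hk.1).mul_prod (hi2 _ hk.2)).const_mul _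
    rw [hL, enorm_smul]
    have hpi : ‖((2 * π)⁻¹ * (2 * π)⁻¹ : ℝ)‖ₑ ≤ 1 := by
      have h3 : (2 * π)⁻¹ ≤ 1 := inv_le_one_of_one_le₀ (by linarith [Real.pi_gt_three])
      rw [Real.enorm_eq_ofReal (by positivity), ENNReal.ofReal_le_one]
      exact mul_le_one₀ h3 (by positivity) h3
    refine (mul_le_of_le_one_left' hpi).trans ((enorm_integral_le_lintegral_enorm _).trans ?_)
    refine lintegral_mono fun s => ?_
    rw [enorm_mul]
    refine mul_le_of_le_one_left' ?_
    rw [← ofReal_norm, Complex.norm_exp]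
    simp
  have hmeas : ∀ ξ : ℤ, Measurable fun q : ℝ × (ℝ × ℝ) =>
      ‖bilF p S₁ S₂ a (f q.2.1) (g q.2.2) ξ q.1‖ₑ := by
    intro ξ
    refine Measurable.enorm (Continuous.measurable ?_)
    unfold bilF
    refine continuous_finsetSum _ fun k _ => ?_
    have h1 := hfc k
    have h2 := hgc (ξ - k)
    have h3 : Continuous fun q : ℝ × (ℝ × ℝ) => f q.2.1 k := h1.comp (by fun_prop)
    have h4 : Continuous fun q : ℝ × (ℝ × ℝ) => g q.2.2 (ξ - k) := h2.comp (by fun_prop)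
    exact ((continuous_const.mul h3).mul h4).mul (by fun_prop)
  let kk : Z × ℝ → ℝ × ℝ → ℝ≥0∞ := fun x s => ‖bilF p S₁ S₂ a (f s.1) (g s.2) x.1 x.2‖ₑ
  have hkk : Measurable (Function.uncurry kk) := by
    exact meas_kk Z (fun ξ t s => ‖bilF p S₁ S₂ a (f s.1) (g s.2) ξ t‖ₑ) hmeas
  have hmk := minkowski2 ((Measure.count : Measure Z).prod (volume.restrict (Set.Ioo A B)))
    (volume : Measure (ℝ × ℝ)) kk hkk
  have hK : Measurable fun x : Z × ℝ => (∫⁻ s, kk x s) ^ 2 :=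
    (hkk.lintegral_prod_right).pow_const 2
  rw [lintegral_prod _ hK.aemeasurable, lintegral_fintype] at hmk
  have hKξ : ∀ ξ : ℤ, Measurable fun t => (∫⁻ s : ℝ × ℝ, ‖bilF p S₁ S₂ a (f s.1) (g s.2) ξ t‖ₑ) ^ 2 :=
    fun ξ => ((hmeas ξ).lintegral_prod_right').pow_const 2
  calc ∫⁻ t in Set.Ioo A B, ∑ ξ ∈ Z, ‖Lam a (V₁ t) (V₂ t) ξ‖ₑ ^ 2
      ≤ ∫⁻ t in Set.Ioo A B, ∑ ξ ∈ Z,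
        (∫⁻ s : ℝ × ℝ, ‖bilF p S₁ S₂ a (f s.1) (g s.2) ξ t‖ₑ) ^ 2 := by
        refine lintegral_mono_ae (ae_restrict_of_ae ?_)
        filter_upwards [hpt] with t ht
        gcongr with ξ _
        exact ht ξ
    _ = ∑ ξ ∈ Z, ∫⁻ t in Set.Ioo A B,
        (∫⁻ s : ℝ × ℝ, ‖bilF p S₁ S₂ a (f s.1) (g s.2) ξ t‖ₑ) ^ 2 :=
        lintegral_finsetSum _ fun ξ _ => hKξ ξ
    _ = ∑ x : Z, (∫⁻ t in Set.Ioo A B, (∫⁻ s, kk (x, t) s) ^ 2) * Measure.count {x} := by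
        rw [← Finset.sum_coe_sort Z]
        refine Finset.sum_congr rfl fun x _ => ?_
        simp [kk]
    _ ≤ _ := hmk
    _ ≤ (∫⁻ s : ℝ × ℝ, (E * ((∑ k ∈ S₁, ‖f s.1 k‖ₑ ^ 2) * ∑ k ∈ S₂, ‖g s.2 k‖ₑ ^ 2)) ^
          ((1:ℝ)/2)) ^ 2 := by
        gcongr with s
        have hks : Measurable fun x => kk x s ^ 2 :=
          (hkk.comp (measurable_prodMk_right (y := s))).pow_const 2
        rw [lintegral_prod _ hks.aemeasurable,
          lintegral_fintype]
        refine le_trans (le_of_eq ?_) (hfree (f s.1) (g s.2))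
        rw [← Finset.sum_coe_sort Z]
        refine Finset.sum_congr rfl fun x _ => ?_
        simp [kk]
    _ = (E ^ ((1:ℝ)/2) * ((∫⁻ σ, (∑ k ∈ S₁, ‖f σ k‖ₑ ^ 2) ^ ((1:ℝ)/2)) *
          ∫⁻ σ, (∑ k ∈ S₂, ‖g σ k‖ₑ ^ 2) ^ ((1:ℝ)/2))) ^ 2 := by
        have hm1 : Measurable fun σ => (∑ k ∈ S₁, ‖f σ k‖ₑ ^ 2) ^ ((1:ℝ)/2) :=
          (Finset.measurable_sum _ fun k _ => (hfc k).measurable.enorm.pow_const 2).pow_const _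
        have hm2 : Measurable fun σ => (∑ k ∈ S₂, ‖g σ k‖ₑ ^ 2) ^ ((1:ℝ)/2) :=
          (Finset.measurable_sum _ fun k _ => (hgc k).measurable.enorm.pow_const 2).pow_const _
        congr 1
        rw [← lintegral_prod_mul hm1.aemeasurable hm2.aemeasurable, ← Measure.volume_eq_prod,
          ← lintegral_const_mul]
        · refine lintegral_congr fun s => ?_
          rw [ENNReal.mul_rpow_of_nonneg _ _ (by norm_num), ENNReal.mul_rpow_of_nonneg _ _ (by norm_num)]
        · exact (hm1.comp measurable_fst).mul (hm2.comp measurable_snd)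
    _ ≤ (E ^ ((1:ℝ)/2) * (ENNReal.ofReal X₁ * ENNReal.ofReal X₂)) ^ 2 := by gcongr
    _ = _ := by
        rw [mul_pow]
        congr 1
        rw [← ENNReal.rpow_natCast, ← ENNReal.rpow_mul]; norm_num

/-- The frequency support of `P_{2^n}`. -/
def dyadS (n : ℕ) : Finset ℤ :=
  (Finset.Icc (-(2 ^ (n + 1) : ℤ)) (2 ^ (n + 1))).filter (fun k => (2:ℝ) ^ n / 2 ≤ |(k : ℝ)|)

lemma mem_dyadS {χ : ℝ → ℝ} (hχ : CutoffFun χ) (n : ℕ) (k : ℤ)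
    (h : lpSymb χ ((2:ℝ) ^ n) k ≠ 0) : k ∈ dyadS n := by
  obtain ⟨h1, h2⟩ := lpSymb_supp hχ (by positivity) h
  rw [dyadS, Finset.mem_filter, Finset.mem_Icc, ← abs_le]
  refine ⟨?_, h2⟩
  have : ((|k| : ℤ) : ℝ) ≤ ((2 ^ (n + 1) : ℤ) : ℝ) := by
    push_cast; rw [pow_succ]; linarith
  exact_mod_cast this

lemma dyadS_le {n : ℕ} {k : ℤ} (h : k ∈ dyadS n) :
    |(k : ℝ)| ≤ 2 * 2 ^ n ∧ (2:ℝ) ^ n / 2 ≤ |(k : ℝ)| := by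
  rw [dyadS, Finset.mem_filter, Finset.mem_Icc, ← abs_le] at h
  refine ⟨?_, h.2⟩
  have : ((|k| : ℤ) : ℝ) ≤ ((2 ^ (n + 1) : ℤ) : ℝ) := by exact_mod_cast h.1
  push_cast at this
  rw [pow_succ] at this
  linarith

/-- Proposition `prop_short4`, estimate (3.4):
short-time bilinear estimate in `X^{0,1/2,1}`: for any interval `I = ]A,B[` with
`|I| ≤ (N₁∨N₂)^{-1} T`,
`‖Λ_a(P_{N₁}u₁,P_{N₂}u₂)‖_{L²(I;L²)} ≤ C T^{1/4}(N₁∨N₂)^{-α/4}‖P_{N₁}u₁‖_X ‖P_{N₂}u₂‖_X`. -/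
theorem short_time_bilinear_I
    (α ξ₀ c₀ C₀ : ℝ) (hα : α ∈ Set.Icc (1:ℝ) 2)
    (p : ℝ → ℝ) (hp : Hyp1 α ξ₀ c₀ C₀ p)
    (χ : ℝ → ℝ) (hχ : CutoffFun χ) :
    ∃ C : ℝ, 0 < C ∧
      ∀ (T : ℝ), 0 < T → T < 1 →
      ∀ (n₁ n₂ : ℕ),
      ∀ (a : ℝ → ℝ → ℂ), (∀ x y : ℝ, ‖a x y‖ ≤ 1) →
      ∀ (U₁ U₂ : ℝ → ℤ → ℂ), MemX χ p U₁ → MemX χ p U₂ →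
      ∀ (A B : ℝ), B - A ≤ (max ((2:ℝ) ^ n₁) ((2:ℝ) ^ n₂))⁻¹ * T →
        L2normOn (Set.Ioo A B)
            (fun t => Lam a (PN χ ((2:ℝ) ^ n₁) (U₁ t)) (PN χ ((2:ℝ) ^ n₂) (U₂ t))) ≤
          C * T ^ ((1:ℝ)/4) * (max ((2:ℝ) ^ n₁) ((2:ℝ) ^ n₂)) ^ (-(α/4)) *
            Xhalf χ p (fun t => PN χ ((2:ℝ) ^ n₁) (U₁ t)) *
            Xhalf χ p (fun t => PN χ ((2:ℝ) ^ n₂) (U₂ t)) := by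
  obtain ⟨K, hK, hfree⟩ := free_bilinear hα hp
  refine ⟨K ^ ((1:ℝ)/2) * (8 * π), by positivity, ?_⟩
  intro T hT hT1 n₁ n₂ a ha U₁ U₂ hU₁ hU₂ A B hAB
  set N : ℝ := max ((2:ℝ) ^ n₁) ((2:ℝ) ^ n₂) with hN
  have hN1 : 1 ≤ N := le_max_of_le_left (one_le_pow₀ one_le_two)
  have hN0 : 0 < N := by linarith
  set V₁ : ℝ → ℤ → ℂ := fun t => PN χ ((2:ℝ) ^ n₁) (U₁ t) with hV₁
  set V₂ : ℝ → ℤ → ℂ := fun t => PN χ ((2:ℝ) ^ n₂) (U₂ t) with hV₂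
  have hi₁ : ∀ k, Integrable fun t => V₁ t k := fun k => (hU₁.2.1 k).const_mul _
  have hi₂ : ∀ k, Integrable fun t => V₂ t k := fun k => (hU₂.2.1 k).const_mul _
  have hz₁ : ∀ k ∉ dyadS n₁, ∀ t, V₁ t k = 0 := by
    intro k hk t
    have : lpSymb χ ((2:ℝ) ^ n₁) k = 0 := by
      by_contra hc
      exact hk (mem_dyadS hχ n₁ k hc)
    simp [hV₁, PN, this]
  have hz₂ : ∀ k ∉ dyadS n₂, ∀ t, V₂ t k = 0 := by
    intro k hk t
    have : lpSymb χ ((2:ℝ) ^ n₂) k = 0 := by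
      by_contra hc
      exact hk (mem_dyadS hχ n₂ k hc)
    simp [hV₂, PN, this]
  have hX₁ := X_bound hχ p V₁ (dyadS n₁) hi₁ hz₁ (PN_summable hχ p _ U₁ hU₁)
  have hX₂ := X_bound hχ p V₂ (dyadS n₂) hi₂ hz₂ (PN_summable hχ p _ U₂ hU₂)
  have hx₁ := Xhalf_nonneg χ p V₁
  have hx₂ := Xhalf_nonneg χ p V₂
  set x₁ := Xhalf χ p V₁
  set x₂ := Xhalf χ p V₂
  let Z : Finset ℤ := Finset.image₂ (fun k l => k + l) (dyadS n₁) (dyadS n₂)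
  have hmain := transfer p V₁ V₂ (dyadS n₁) (dyadS n₂) Z _ _ A B
    (ENNReal.ofReal (K * (T ^ ((1:ℝ)/2) * N ^ (-(α/2))))) a hi₁ hi₂ hz₁ hz₂ hX₁ hX₂
    (hfree N T hN1 hT hT1 (dyadS n₁) (dyadS n₂)
      (fun k hk => (dyadS_le hk).1.trans (by
        have := le_max_left ((2:ℝ) ^ n₁) ((2:ℝ) ^ n₂)
        linarith))
      (fun k hk l hl => by
        have h1 := (dyadS_le hk).2
        have h2 := (dyadS_le hl).2
        rcases max_choice ((2:ℝ) ^ n₁) ((2:ℝ) ^ n₂) with h | h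
        · rw [hN, h]; exact h1.trans (le_max_left _ _)
        · rw [hN, h]; exact h2.trans (le_max_right _ _))
      a ha A B hAB Z)
  have hLz : ∀ t, ∀ ξ ∉ Z, Lam a (V₁ t) (V₂ t) ξ = 0 := by
    intro t ξ hξ
    rw [Lam]
    convert tsum_zero with k
    by_cases hk : k ∈ dyadS n₁
    · rw [hz₂ (ξ - k), mul_zero]
      intro hl
      exact hξ (Finset.mem_image₂.2 ⟨k, hk, ξ - k, hl, by ring⟩)
    · rw [hz₁ k hk]; simp
  have hle : ∀ t, ‖l2sq (Lam a (V₁ t) (V₂ t))‖ₑ = ∑ ξ ∈ Z, ‖Lam a (V₁ t) (V₂ t) ξ‖ₑ ^ 2 := by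
    intro t
    have e : l2sq (Lam a (V₁ t) (V₂ t)) = ∑ ξ ∈ Z, ‖Lam a (V₁ t) (V₂ t) ξ‖ ^ 2 := by
      rw [l2sq, tsum_eq_sum]
      intro ξ hξ
      rw [hLz t ξ hξ]; simp
    rw [e, Real.enorm_eq_ofReal (Finset.sum_nonneg fun _ _ => by positivity),
      ENNReal.ofReal_sum_of_nonneg (fun _ _ => by positivity)]
    refine Finset.sum_congr rfl fun k _ => ?_
    rw [ENNReal.ofReal_pow (norm_nonneg _), ofReal_norm]
  have hI0 : 0 ≤ ∫ t in Set.Ioo A B, l2sq (Lam a (V₁ t) (V₂ t)) :=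
    integral_nonneg fun t => tsum_nonneg fun _ => by positivity
  have hR : (∫ t in Set.Ioo A B, l2sq (Lam a (V₁ t) (V₂ t))) ≤
      K * (T ^ ((1:ℝ)/2) * N ^ (-(α/2))) * ((8 * π) * x₁ * x₂) ^ 2 := by
    rw [← ENNReal.ofReal_le_ofReal_iff (by positivity), ← Real.enorm_eq_ofReal hI0]
    refine (enorm_integral_le_lintegral_enorm _).trans ?_
    simp_rw [hle]
    refine hmain.trans (le_of_eq ?_)
    rw [← ENNReal.ofReal_mul (by positivity), ← ENNReal.ofReal_pow (by positivity),
      ← ENNReal.ofReal_mul (by positivity)]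
    congr 2
    have : (8 * π) ^ ((1:ℝ)/2) * (8 * π) ^ ((1:ℝ)/2) = 8 * π := by
      rw [← Real.rpow_add (by positivity)]; norm_num
    congr 1
    linear_combination (x₁ * x₂) * this
  rw [L2normOn]
  refine (Real.rpow_le_rpow hI0 hR (by norm_num)).trans (le_of_eq ?_)
  rw [Real.mul_rpow (by positivity) (by positivity), Real.mul_rpow (by positivity) (by positivity),
    Real.mul_rpow (by positivity) (by positivity), ← Real.rpow_mul hT.le, ← Real.rpow_mul hN0.le,
    ← Real.sqrt_eq_rpow (_ ^ 2), Real.sqrt_sq (by positivity)]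
  have e1 : (1:ℝ) / 2 * (1 / 2) = 1 / 4 := by norm_num
  have e2 : -(α / 2) * (1 / 2) = -(α / 4) := by ring
  rw [e1, e2]
  ring

end
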